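/- Let n ≥ 3 and 1 < p < ∞. A map Z : P_o^n → K_o^n is an SL(n) covariant L_p Minkowski valuation if and only if there exist constants c₁, c₂, c₃, c₄ ≥ 0 such that ZP = c₁·M_p⁺P +_p c₂·M_p⁻P +_p c₃·P +_p c₄·(−P) for every P ∈ P_o^n. -/

import Mathlib

open scoped RealInnerProductSpace BigOperators Pointwise ENNReal
open MeasureTheory Filter Matrix

noncomputable section

/-- `Euc n` is Euclidean space `ℝ^n`. -/
abbrev Euc (n : ℕ) := EuclideanSpace ℝ (Fin n)

/-- A convex body in `ℝ^n` containing the origin: a nonempty compact convex set with `0 ∈ K`. -/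
def IsConvexBody0 {n : ℕ} (K : Set (Euc n)) : Prop :=
  IsCompact K ∧ Convex ℝ K ∧ (0 : Euc n) ∈ K

/-- A convex polytope in `ℝ^n` containing the origin. -/
def IsPolytope0 {n : ℕ} (P : Set (Euc n)) : Prop :=
  (∃ S : Finset (Euc n), P = convexHull ℝ (S : Set (Euc n))) ∧ (0 : Euc n) ∈ P

/-- The support function `h_K(x) = sup { ⟪x, y⟫ : y ∈ K }`. -/
def supp {n : ℕ} (K : Set (Euc n)) (x : Euc n) : ℝ :=
  sSup ((fun y => ⟪x, y⟫) '' K)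

/-- The image of a set under the linear map induced by a matrix. -/
def matAct {n : ℕ} (A : Matrix (Fin n) (Fin n) ℝ) (K : Set (Euc n)) : Set (Euc n) :=
  (Matrix.toEuclideanLin A) '' K

/-- The vector `A x`. -/
def matVec {n : ℕ} (A : Matrix (Fin n) (Fin n) ℝ) (x : Euc n) : Euc n :=
  Matrix.toEuclideanLin A x

/-- The dimension of a set: the dimension of (the direction of) its affine hull. -/
def sdim {n : ℕ} (P : Set (Euc n)) : ℕ :=
  Module.finrank ℝ (affineSpan ℝ P).direction

/-- Support function of the asymmetric `L_p` moment body: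
`h_{M_p⁺K}(x) = (∫_K max(⟪x,y⟫,0)^p dy)^(1/p)`. -/
def mPlus {n : ℕ} (p : ℝ) (K : Set (Euc n)) (x : Euc n) : ℝ :=
  (∫ y in K, max ⟪x, y⟫ 0 ^ p) ^ (1 / p)

/-- Support function of the asymmetric `L_p` moment body `M_p⁻`. -/
def mMinus {n : ℕ} (p : ℝ) (K : Set (Euc n)) (x : Euc n) : ℝ :=
  (∫ y in K, max (-⟪x, y⟫) 0 ^ p) ^ (1 / p)

/-- `Z` is `SL(n)` covariant on polytopes containing the origin. -/
def SLCovariant {n : ℕ} (Z : Set (Euc n) → Set (Euc n)) : Prop :=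
  ∀ (φ : Matrix.SpecialLinearGroup (Fin n) ℝ) (P : Set (Euc n)), IsPolytope0 P →
    Z (matAct (φ : Matrix (Fin n) (Fin n) ℝ) P) = matAct (φ : Matrix (Fin n) (Fin n) ℝ) (Z P)

/-- `Z` is an `L_p` Minkowski valuation on polytopes containing the origin, expressed via
support functions: `h_{Z(K∪L)}^p + h_{Z(K∩L)}^p = h_{ZK}^p + h_{ZL}^p`. -/
def ValuationLp {n : ℕ} (p : ℝ) (Z : Set (Euc n) → Set (Euc n)) : Prop :=
  ∀ K L : Set (Euc n), IsPolytope0 K → IsPolytope0 L → IsPolytope0 (K ∪ L) →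
    IsPolytope0 (K ∩ L) → ∀ x : Euc n,
    supp (Z (K ∪ L)) x ^ p + supp (Z (K ∩ L)) x ^ p = supp (Z K) x ^ p + supp (Z L) x ^ p

section Determination

variable {V : Type} [AddCommGroup V] [Module ℝ V]

/-- A polytope containing the origin in a real vector space. -/
def IsOriginPolytope (P : Set V) : Prop :=
  (∃ S : Finset V, P = convexHull ℝ (S : Set V)) ∧ (0 : V) ∈ P

lemma Convex.exists_sum_smul_eq {Q : Set V} (hQ : Convex ℝ Q) (hne : Q.Nonempty) {ι : Type}
    (s : Finset ι) (r : ι → ℝ) (q : ι → V) (hr : ∀ i ∈ s, 0 ≤ r i)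
    (hq : ∀ i ∈ s, r i ≠ 0 → q i ∈ Q) :
    ∃ z ∈ Q, ∑ i ∈ s, r i • q i = (∑ i ∈ s, r i) • z := by
  classical
  rcases (Finset.sum_nonneg hr).eq_or_lt with h | h
  · obtain ⟨z, hz⟩ := hne
    refine ⟨z, hz, ?_⟩
    rw [← h, zero_smul]
    refine Finset.sum_eq_zero fun i hi => ?_
    rw [(Finset.sum_eq_zero_iff_of_nonneg hr).1 h.symm i hi, zero_smul]
  · refine ⟨∑ i ∈ s, (r i / ∑ j ∈ s, r j) • q i, ?_, ?_⟩
    · have hs : ∑ i ∈ s.filter (fun i => r i ≠ 0), r i = ∑ i ∈ s, r i := Finset.sum_filter_ne_zero s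
      have : ∑ i ∈ s.filter (fun i => r i ≠ 0), (r i / ∑ j ∈ s, r j) • q i =
          ∑ i ∈ s, (r i / ∑ j ∈ s, r j) • q i := by
        refine Finset.sum_filter_of_ne fun i _ hi h0 => hi ?_
        rw [h0, zero_div, zero_smul]
      rw [← this]
      refine hQ.sum_mem (fun i hi => ?_) ?_ fun i hi => ?_
      · exact div_nonneg (hr i (Finset.mem_filter.1 hi).1) h.le
      · rw [← Finset.sum_div, hs, div_self h.ne']
      · exact hq i (Finset.mem_filter.1 hi).1 (Finset.mem_filter.1 hi).2
    · rw [Finset.smul_sum]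
      refine Finset.sum_congr rfl fun i _ => ?_
      rw [smul_smul, mul_div_cancel₀ _ h.ne']

lemma IsOriginPolytope.convex {P : Set V} (hP : IsOriginPolytope P) : Convex ℝ P := by
  obtain ⟨⟨S, rfl⟩, -⟩ := hP
  exact convex_convexHull ℝ _

lemma IsOriginPolytope.inter_halfspace {P : Set V} (hP : IsOriginPolytope P) (k : V →ₗ[ℝ] ℝ) :
    IsOriginPolytope (P ∩ {y | k y ≤ 0}) := by
  classical
  obtain ⟨⟨S, rfl⟩, h0⟩ := hP
  refine ⟨?_, h0, by simp⟩
  set Sm := S.filter (fun s => k s ≤ 0)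
  set Sp := S.filter (fun s => ¬ k s ≤ 0)
  set cr : V × V → V := fun q => (k q.1 - k q.2)⁻¹ • (k q.1 • q.2 - k q.2 • q.1) with hcr
  set Q := convexHull ℝ ((Sm ∪ (Sp ×ˢ Sm).image cr : Finset V) : Set V) with hQ
  have hQc : Convex ℝ Q := convex_convexHull ℝ _
  have hmQ : ∀ t ∈ Sm, t ∈ Q := fun t ht =>
    subset_convexHull ℝ _ (by simpa using Or.inl ht)
  have hcQ : ∀ q ∈ Sp ×ˢ Sm, cr q ∈ Q := fun q hq =>
    subset_convexHull ℝ _ (by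
      rw [Finset.mem_coe, Finset.mem_union]; exact Or.inr (Finset.mem_image_of_mem _ hq))
  refine ⟨Sm ∪ (Sp ×ˢ Sm).image cr, ?_⟩
  change _ = Q
  apply Set.Subset.antisymm
  · rintro y ⟨hy, hky⟩
    obtain ⟨w, hw0, hw1, rfl⟩ := Finset.mem_convexHull'.1 hy
    have hsp : ∀ {M : Type} [AddCommMonoid M] (f : V → M),
        ∑ s ∈ S, f s = ∑ s ∈ Sm, f s + ∑ s ∈ Sp, f s := fun f =>
      (Finset.sum_filter_add_sum_filter_not S _ f).symm
    have hwm : ∀ s ∈ Sm, 0 ≤ w s := fun s hs => hw0 s (Finset.mem_filter.1 hs).1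
    have hwp : ∀ s ∈ Sp, 0 ≤ w s := fun s hs => hw0 s (Finset.mem_filter.1 hs).1
    have hkm : ∀ s ∈ Sm, k s ≤ 0 := fun s hs => (Finset.mem_filter.1 hs).2
    have hkp : ∀ s ∈ Sp, 0 < k s := fun s hs => not_le.1 (Finset.mem_filter.1 hs).2
    set a := ∑ s ∈ Sp, w s * k s with ha
    set b := -∑ s ∈ Sm, w s * k s with hb
    have hab : a ≤ b := by
      have : k (∑ s ∈ S, w s • s) ≤ 0 := hky
      rw [map_sum, hsp] at this
      simp only [map_smul, smul_eq_mul] at this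
      linarith
    have ha0 : 0 ≤ a := Finset.sum_nonneg fun s hs => mul_nonneg (hwp s hs) (hkp s hs).le
    rcases ha0.eq_or_lt with h | h
    · have hz : ∀ s ∈ Sp, w s = 0 := fun s hs => by
        have := (Finset.sum_eq_zero_iff_of_nonneg
          (fun s hs => mul_nonneg (hwp s hs) (hkp s hs).le)).1 h.symm s hs
        rcases mul_eq_zero.1 this with h' | h'
        · exact h'
        · exact absurd h' (hkp s hs).ne'
      rw [hsp, Finset.sum_eq_zero (s := Sp) (fun s hs => by rw [hz s hs, zero_smul]), add_zero]
      refine hQc.sum_mem hwm ?_ hmQ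
      rw [← hw1, hsp, Finset.sum_eq_zero (s := Sp) hz, add_zero]
    · have hb0 : 0 < b := h.trans_le hab
      have hSm : Sm.Nonempty := by
        by_contra hne
        rw [Finset.not_nonempty_iff_eq_empty] at hne
        rw [hb, hne] at hb0
        simp at hb0
      have hQne : Q.Nonempty := hSm.imp fun t ht => hmQ t ht
      obtain ⟨z₁, hz₁, e₁⟩ := hQc.exists_sum_smul_eq hQne Sm w id hwm (fun t ht _ => hmQ t ht)
      obtain ⟨z₂, hz₂, e₂⟩ := hQc.exists_sum_smul_eq hQne (Sp ×ˢ Sm)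
        (fun q => w q.1 * w q.2 * (k q.1 - k q.2)) cr
        (fun q hq => by
          rw [Finset.mem_product] at hq
          have := hkp _ hq.1
          have := hkm _ hq.2
          exact mul_nonneg (mul_nonneg (hwp _ hq.1) (hwm _ hq.2)) (by linarith))
        (fun q hq _ => hcQ q hq)
      have e₂' : ∑ q ∈ Sp ×ˢ Sm, (w q.1 * w q.2 * (k q.1 - k q.2)) • cr q
          = a • ∑ s ∈ Sm, w s • s + b • ∑ s ∈ Sp, w s • s := by
        have : ∀ q ∈ Sp ×ˢ Sm, (w q.1 * w q.2 * (k q.1 - k q.2)) • cr q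
            = (w q.1 * k q.1) • w q.2 • q.2 - (w q.2 * k q.2) • w q.1 • q.1 := by
          intro q hq
          rw [Finset.mem_product] at hq
          have h1 := hkp _ hq.1
          have h2 := hkm _ hq.2
          have h3 : k q.1 - k q.2 ≠ 0 := by linarith
          simp only [hcr]
          rw [smul_smul, mul_assoc, mul_inv_cancel₀ h3]
          module
        rw [Finset.sum_congr rfl this, Finset.sum_sub_distrib, Finset.sum_product,
          Finset.sum_product_right, ha, hb]
        simp only [← Finset.smul_sum, ← Finset.sum_smul]
        module
      have r₂ : ∑ q ∈ Sp ×ˢ Sm, w q.1 * w q.2 * (k q.1 - k q.2)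
          = a * ∑ s ∈ Sm, w s + b * ∑ s ∈ Sp, w s := by
        have : ∀ q ∈ Sp ×ˢ Sm, w q.1 * w q.2 * (k q.1 - k q.2)
            = (w q.1 * k q.1) * w q.2 - (w q.2 * k q.2) * w q.1 := fun q _ => by ring
        rw [Finset.sum_congr rfl this, Finset.sum_sub_distrib, Finset.sum_product,
          Finset.sum_product_right, ha, hb]
        simp only [← Finset.mul_sum, ← Finset.sum_mul]
        ring
      rw [e₂', r₂] at e₂
      have e : ∑ s ∈ S, w s • s = ((1 - a / b) * ∑ s ∈ Sm, w s) • z₁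
          + (b⁻¹ * (a * ∑ s ∈ Sm, w s + b * ∑ s ∈ Sp, w s)) • z₂ := by
        rw [mul_smul, mul_smul, ← e₁, ← e₂, hsp]
        simp only [id, smul_add, smul_smul]
        rw [inv_mul_cancel₀ hb0.ne', div_eq_inv_mul]
        module
      rw [e]
      refine hQc hz₁ hz₂ ?_ ?_ ?_
      · have : a / b ≤ 1 := (div_le_one hb0).2 hab
        exact mul_nonneg (by linarith) (Finset.sum_nonneg hwm)
      · have := Finset.sum_nonneg hwm
        have := Finset.sum_nonneg hwp
        positivity
      · rw [hsp] at hw1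
        refine Eq.trans ?_ hw1
        field_simp
        ring
  · refine convexHull_min ?_ ((convex_convexHull ℝ _).inter ?_)
    · intro y hy
      rw [Finset.mem_coe, Finset.mem_union] at hy
      rcases hy with hy | hy
      · exact ⟨subset_convexHull ℝ _ (Finset.mem_filter.1 hy).1, (Finset.mem_filter.1 hy).2⟩
      · obtain ⟨q, hq, rfl⟩ := Finset.mem_image.1 hy
        rw [Finset.mem_product, Finset.mem_filter, Finset.mem_filter] at hq
        obtain ⟨⟨h1, h1'⟩, h2, h2'⟩ := hq
        rw [not_le] at h1'
        have h3 : 0 < k q.1 - k q.2 := by linarith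
        constructor
        · have : cr q = ((k q.1 - k q.2)⁻¹ * k q.1) • q.2
              + ((k q.1 - k q.2)⁻¹ * (-k q.2)) • q.1 := by
            simp only [hcr]; module
          rw [this]
          refine (convex_convexHull ℝ _) (subset_convexHull ℝ _ h2) (subset_convexHull ℝ _ h1)
            (by positivity) (mul_nonneg (by positivity) (by linarith)) ?_
          field_simp
          ring
        · simp only [hcr, Set.mem_ofPred_eq, map_smul, map_sub, smul_eq_mul]
          apply le_of_eq
          ring
    · exact convex_halfSpace_le k.isLinear 0

lemma IsOriginPolytope.inter_halfspace_ge {P : Set V} (hP : IsOriginPolytope P) (k : V →ₗ[ℝ] ℝ) :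
    IsOriginPolytope (P ∩ {y | 0 ≤ k y}) := by
  simpa using hP.inter_halfspace (-k)

lemma IsOriginPolytope.inter_hyperplane {P : Set V} (hP : IsOriginPolytope P) (k : V →ₗ[ℝ] ℝ) :
    IsOriginPolytope (P ∩ {y | k y = 0}) := by
  have : P ∩ {y | k y = 0} = P ∩ {y | k y ≤ 0} ∩ {y | 0 ≤ k y} := by
    ext y
    simp only [Set.mem_inter_iff, Set.mem_ofPred_eq, and_assoc, le_antisymm_iff]
  rw [this]
  exact (hP.inter_halfspace k).inter_halfspace_ge k

lemma IsOriginPolytope.bddAbove {P : Set V} (hP : IsOriginPolytope P) (k : V →ₗ[ℝ] ℝ) : ∃ B, ∀ y ∈ P, k y ≤ B := by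
  classical
  obtain ⟨⟨S, rfl⟩, -⟩ := hP
  obtain ⟨B, hB⟩ := (S.image k).bddAbove
  refine ⟨B, fun y hy => ?_⟩
  refine convexHull_min (t := {y | k y ≤ B}) (fun s hs => ?_) (convex_halfSpace_le k.isLinear B) hy
  exact hB (by simpa using ⟨s, hs, rfl⟩)

lemma IsOriginPolytope.map {W : Type} [AddCommGroup W] [Module ℝ W] {P : Set V} (hP : IsOriginPolytope P)
    (f : V →ₗ[ℝ] W) : IsOriginPolytope (f '' P) := by
  classical
  obtain ⟨⟨S, rfl⟩, h0⟩ := hP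
  refine ⟨⟨S.image f, ?_⟩, 0, h0, map_zero f⟩
  rw [f.image_convexHull, Finset.coe_image]

lemma IsOriginPolytope.eq_zero_of_ray {P : Set V} (hP : IsOriginPolytope P) {y : V} (hy : ∀ t : ℝ, 0 ≤ t → t • y ∈ P) :
    y = 0 := by
  by_contra hne
  obtain ⟨k, hk⟩ : ∃ k : V →ₗ[ℝ] ℝ, k y ≠ 0 := by
    by_contra! h
    exact hne ((Module.forall_dual_apply_eq_zero_iff ℝ y).1 h)
  wlog hpos : 0 < k y generalizing k
  · exact this (-k) (by simpa using hk)
      (by simpa using lt_of_le_of_ne (not_lt.1 hpos) hk)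
  obtain ⟨B, hB⟩ := hP.bddAbove k
  have h1 := hB _ (hy ((|B| + 1) / k y) (by positivity))
  rw [map_smul, smul_eq_mul, div_mul_cancel₀ _ hpos.ne'] at h1
  linarith [le_abs_self B]

/-- Fourier–Motzkin elimination: a finitely generated cone is a finite intersection of
half-spaces. -/
lemma exists_halfspaces_cone [FiniteDimensional ℝ V] {ι : Type} (S : Finset ι) (v : ι → V) :
    ∃ K : Finset (V →ₗ[ℝ] ℝ), ∀ y,
      (∃ t : ι → ℝ, (∀ i ∈ S, 0 ≤ t i) ∧ ∑ i ∈ S, t i • v i = y) ↔ ∀ k ∈ K, k y ≤ 0 := by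
  classical
  induction S using Finset.induction_on with
  | empty =>
    let b := Module.finBasis ℝ V
    refine ⟨Finset.univ.image b.coord ∪ Finset.univ.image (fun i => -b.coord i), fun y => ?_⟩
    simp only [Finset.notMem_empty, false_imp_iff, implies_true, Finset.sum_empty, true_and,
      exists_const, Finset.mem_union, Finset.mem_image, Finset.mem_univ]
    constructor
    · rintro rfl k -
      simp
    · intro h
      symm
      apply b.ext_elem
      intro i
      have h1 := h _ (Or.inl ⟨i, rfl⟩)
      have h2 := h _ (Or.inr ⟨i, rfl⟩)
      simp only [Module.Basis.coord_apply, LinearMap.neg_apply] at h1 h2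
      simp only [map_zero, Finsupp.coe_zero, Pi.zero_apply]
      linarith
  | insert a S ha ih =>
    obtain ⟨K, hK⟩ := ih
    set g := v a
    have key : ∀ y, (∃ t : ι → ℝ, (∀ i ∈ insert a S, 0 ≤ t i) ∧ ∑ i ∈ insert a S, t i • v i = y) ↔
        ∃ τ : ℝ, 0 ≤ τ ∧ ∀ k ∈ K, k y ≤ τ * k g := by
      intro y
      constructor
      · rintro ⟨t, ht, e⟩
        refine ⟨t a, ht a (by simp), fun k hk => ?_⟩
        have := (hK (y - t a • g)).1 ⟨t, fun i hi => ht i (by simp [hi]), by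
          rw [← e, Finset.sum_insert ha]; simp [g]⟩ k hk
        simpa using this
      · rintro ⟨τ, hτ, h⟩
        obtain ⟨t, ht, e⟩ := (hK (y - τ • g)).2 (fun k hk => by simpa using h k hk)
        refine ⟨Function.update t a τ, fun i hi => ?_, ?_⟩
        · by_cases hia : i = a
          · subst hia; simpa using hτ
          · rw [Function.update_of_ne hia]
            exact ht i ((Finset.mem_insert.1 hi).resolve_left hia)
        · rw [Finset.sum_insert ha, Function.update_self]
          have : ∑ i ∈ S, Function.update t a τ i • v i = ∑ i ∈ S, t i • v i :=
            Finset.sum_congr rfl fun i hi => by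
              rw [Function.update_of_ne (by rintro rfl; exact ha hi)]
          rw [this, e]
          simp [g]
    refine ⟨K.filter (fun k => k g ≤ 0) ∪
      ((K.filter (fun k => 0 < k g)) ×ˢ (K.filter (fun k => k g < 0))).image
        (fun q => q.1 g • q.2 - q.2 g • q.1), fun y => (key y).trans ⟨?_, ?_⟩⟩
    · rintro ⟨τ, hτ, h⟩ k hk
      rcases Finset.mem_union.1 hk with hk | hk
      · rw [Finset.mem_filter] at hk
        exact (h k hk.1).trans (mul_nonpos_of_nonneg_of_nonpos hτ hk.2)
      · obtain ⟨⟨p, q⟩, hpq, rfl⟩ := Finset.mem_image.1 hk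
        simp only [Finset.mem_product, Finset.mem_filter] at hpq
        obtain ⟨⟨hp, hp'⟩, hq, hq'⟩ := hpq
        have h1 := h p hp
        have h2 := h q hq
        simp only [LinearMap.sub_apply, LinearMap.smul_apply, smul_eq_mul]
        nlinarith
    · intro h
      set T : Finset ℝ := insert 0 ((K.filter (fun k => 0 < k g)).image (fun k => k y / k g))
      have hT : T.Nonempty := Finset.insert_nonempty _ _
      refine ⟨T.max' hT, T.le_max' 0 (Finset.mem_insert_self _ _), fun k hk => ?_⟩
      rcases lt_trichotomy (k g) 0 with hg | hg | hg
      · rcases Finset.mem_insert.1 (T.max'_mem hT) with h' | h'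
        · rw [h', zero_mul]
          exact h k (Finset.mem_union_left _ (Finset.mem_filter.2 ⟨hk, hg.le⟩))
        · obtain ⟨p, hp, e⟩ := Finset.mem_image.1 h'
          rw [← e]
          rw [Finset.mem_filter] at hp
          have := h (p g • k - k g • p) (Finset.mem_union_right _ (Finset.mem_image.2
            ⟨(p, k), by simp [hp.1, hp.2, hk, hg], rfl⟩))
          simp only [LinearMap.sub_apply, LinearMap.smul_apply, smul_eq_mul] at this
          rw [div_mul_eq_mul_div, le_div_iff₀ hp.2]
          linarith
      · rw [hg, mul_zero]
        exact h k (Finset.mem_union_left _ (Finset.mem_filter.2 ⟨hk, hg.le⟩))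
      · rw [← div_le_iff₀ hg]
        exact T.le_max' _ (Finset.mem_insert_of_mem (Finset.mem_image.2
          ⟨k, Finset.mem_filter.2 ⟨hk, hg⟩, rfl⟩))

lemma IsOriginPolytope.exists_halfspaces [FiniteDimensional ℝ V] {P : Set V} (hP : IsOriginPolytope P) :
    ∃ L K : Finset (V →ₗ[ℝ] ℝ), P = {y | (∀ l ∈ L, l y ≤ 1) ∧ ∀ k ∈ K, k y ≤ 0} := by
  classical
  obtain ⟨⟨S, rfl⟩, h0⟩ := hP
  obtain ⟨K, hK⟩ := exists_halfspaces_cone S (fun s : V => ((s, 1) : V × ℝ))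
  have hmem : ∀ y, y ∈ convexHull ℝ (S : Set V) ↔ ∀ k ∈ K, k (y, 1) ≤ 0 := by
    intro y
    rw [← hK, Finset.mem_convexHull']
    refine exists_congr fun t => and_congr_right fun _ => ?_
    rw [Prod.ext_iff]
    simp [Prod.fst_sum, Prod.snd_sum, and_comm]
  have hsplit : ∀ (k : V × ℝ →ₗ[ℝ] ℝ) y, k (y, 1) = k (y, 0) + k (0, 1) := fun k y => by
    rw [← map_add]; simp
  have hc : ∀ k ∈ K, k (0, 1) ≤ 0 := (hmem 0).1 h0
  refine ⟨(K.filter (fun k => k (0, 1) < 0)).image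
      (fun k => (-(k (0, 1)))⁻¹ • k.comp (LinearMap.inl ℝ V ℝ)),
    (K.filter (fun k => k (0, 1) = 0)).image (fun k => k.comp (LinearMap.inl ℝ V ℝ)), ?_⟩
  ext y
  rw [hmem]
  simp only [Finset.mem_image, Finset.mem_filter, Set.mem_ofPred_eq, forall_exists_index, and_imp]
  constructor
  · intro h
    constructor
    · rintro _ k hk hk0 rfl
      have := h k hk
      rw [hsplit] at this
      simp only [LinearMap.smul_apply, LinearMap.comp_apply, LinearMap.inl_apply, smul_eq_mul]
      rw [inv_mul_le_iff₀ (by linarith)]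
      linarith
    · rintro _ k hk hk0 rfl
      have := h k hk
      rw [hsplit, hk0] at this
      simpa using this
  · rintro ⟨h1, h2⟩ k hk
    rw [hsplit]
    rcases (hc k hk).lt_or_eq with h | h
    · have := h1 _ k hk h rfl
      simp only [LinearMap.smul_apply, LinearMap.comp_apply, LinearMap.inl_apply, smul_eq_mul]
        at this
      rw [inv_mul_le_iff₀ (by linarith)] at this
      linarith
    · have := h2 _ k hk h rfl
      simp only [LinearMap.comp_apply, LinearMap.inl_apply] at this
      linarith

end Determination

section Vanishing

variable {V : Type} [AddCommGroup V] [Module ℝ V]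

/-- The additivity of a valuation under cuts by hyperplanes through the origin. -/
def HyperplaneAdditive (F : Set V → ℝ) : Prop :=
  ∀ P, IsOriginPolytope P → ∀ k : V →ₗ[ℝ] ℝ,
    F P + F (P ∩ {y | k y = 0}) = F (P ∩ {y | k y ≤ 0}) + F (P ∩ {y | 0 ≤ k y})

/-- The part of a polyhedral cone lying in a half-space. -/
def truncatedCone {N : ℕ} (l : V →ₗ[ℝ] ℝ) (k : Fin N → V →ₗ[ℝ] ℝ) : Set V :=
  {y | l y ≤ 1 ∧ ∀ i, k i y ≤ 0}

lemma truncatedCone_eq_convexHull [FiniteDimensional ℝ V] {N : ℕ} (l : V →ₗ[ℝ] ℝ)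
    (k : Fin N → V →ₗ[ℝ] ℝ) (hk : LinearIndependent ℝ k)
    (hP : IsOriginPolytope (truncatedCone l k)) :
    ∃ v : Fin N → V, LinearIndependent ℝ v ∧
      truncatedCone l k = convexHull ℝ (insert 0 (Set.range v)) := by
  classical
  have hinj : ∀ y, (∀ i, k i y = 0) → y = 0 := by
    intro y hy
    wlog hl : l y ≤ 0 generalizing y
    · exact neg_eq_zero.1 (this (-y) (by simpa using hy) (by rw [map_neg]; linarith))
    · refine hP.eq_zero_of_ray fun t ht => ⟨?_, fun i => ?_⟩
      · rw [map_smul, smul_eq_mul]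
        nlinarith
      · rw [map_smul, hy i, smul_zero]
  have hfr : Module.finrank ℝ V = Module.finrank ℝ (Fin N → ℝ) := by
    apply le_antisymm
    · refine LinearMap.finrank_le_finrank_of_injective (f := LinearMap.pi k) ?_
      rw [injective_iff_map_eq_zero]
      exact fun y hy => hinj y fun i => congrFun hy i
    · have := hk.fintype_card_le_finrank
      rw [Subspace.dual_finrank_eq] at this
      simpa using this
  let e : V ≃ₗ[ℝ] (Fin N → ℝ) := LinearEquiv.ofInjectiveOfFinrankEq (LinearMap.pi k)
    (by
      rw [injective_iff_map_eq_zero]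
      exact fun y hy => hinj y fun i => congrFun hy i) hfr
  have he : ∀ y i, e y i = k i y := fun y i => rfl
  let b : Module.Basis (Fin N) ℝ V := Module.Basis.ofEquivFun e
  have hb : ∀ i j, k i (b j) = if i = j then 1 else 0 := fun i j => by
    rw [← he, Module.Basis.coe_ofEquivFun, LinearEquiv.apply_symm_apply, Pi.single_apply]
  have hrep : ∀ y, y = ∑ i, k i y • b i := fun y => by
    conv_lhs => rw [← b.sum_repr y]
    rfl
  have hl : ∀ i, l (b i) < 0 := by
    intro i
    by_contra! h
    refine b.ne_zero i (neg_eq_zero.1 (hP.eq_zero_of_ray fun t ht => ⟨?_, fun j => ?_⟩))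
    · rw [map_smul, map_neg, smul_eq_mul]
      nlinarith
    · rw [map_smul, map_neg, hb, smul_eq_mul]
      split_ifs <;> simp [ht]
  refine ⟨fun i => (l (b i))⁻¹ • b i, ?_, ?_⟩
  · exact b.linearIndependent.units_smul (fun i => (Units.mk0 _ (hl i).ne)⁻¹)
  apply Set.Subset.antisymm
  · rintro y ⟨hy, hky⟩
    have hsum : l y = ∑ i, k i y * l (b i) := by
      conv_lhs => rw [hrep y, map_sum]
      simp
    have : y = (1 - l y) • (0 : V) + ∑ i, (k i y * l (b i)) • (l (b i))⁻¹ • b i := by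
      rw [smul_zero, zero_add]
      conv_lhs => rw [hrep y]
      refine Finset.sum_congr rfl fun i _ => ?_
      rw [smul_smul, mul_assoc, mul_inv_cancel₀ (hl i).ne, mul_one]
    rw [this]
    have hc := (convex_convexHull ℝ (insert 0 (Set.range fun i => (l (b i))⁻¹ • b i))).sum_mem
      (t := Finset.univ) (w := fun o : Option (Fin N) => o.elim (1 - l y) fun i => k i y * l (b i))
      (z := fun o : Option (Fin N) => o.elim 0 fun i => (l (b i))⁻¹ • b i)
    rw [Fintype.sum_option, Fintype.sum_option] at hc
    refine hc ?_ ?_ ?_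
    · rintro (_ | i) -
      · exact sub_nonneg.2 hy
      · exact mul_nonneg_of_nonpos_of_nonpos (hky i) (hl i).le
    · simp [← hsum]
    · rintro (_ | i) - <;> apply subset_convexHull
      · exact Set.mem_insert _ _
      · exact Set.mem_insert_of_mem _ ⟨i, rfl⟩
  · refine convexHull_min (Set.insert_subset hP.2 ?_) hP.convex
    rintro _ ⟨i, rfl⟩
    refine ⟨?_, fun j => ?_⟩
    · rw [map_smul, smul_eq_mul, inv_mul_cancel₀ (hl i).ne]
    · rw [map_smul, hb, smul_eq_mul]
      have := inv_nonpos.2 (hl i).le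
      split_ifs <;> simp [this]

/-- `F` vanishes on the polytopes contained in some hyperplane through the origin. -/
def VanishesOnHyperplanes (F : Set V → ℝ) : Prop :=
  ∀ P, IsOriginPolytope P → ∀ k : V →ₗ[ℝ] ℝ, k ≠ 0 → (∀ y ∈ P, k y = 0) → F P = 0

lemma HyperplaneAdditive.eq_zero_of_halves {F : Set V → ℝ} (hF : HyperplaneAdditive F)
    (hlow : VanishesOnHyperplanes F) {P : Set V} (hP : IsOriginPolytope P) {k : V →ₗ[ℝ] ℝ}
    (hk : k ≠ 0) (h1 : F (P ∩ {y | k y ≤ 0}) = 0) (h2 : F (P ∩ {y | 0 ≤ k y}) = 0) : F P = 0 := by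
  have := hF P hP k
  rw [h1, h2, hlow _ (hP.inter_hyperplane k) k hk fun y hy => hy.2] at this
  linarith

lemma truncatedCone_drop {N : ℕ} (l : V →ₗ[ℝ] ℝ) (k : Fin (N + 1) → V →ₗ[ℝ] ℝ) (i : Fin (N + 1))
    (h : ∀ y, (∀ j, j ≠ i → k j y ≤ 0) → k i y ≤ 0) :
    truncatedCone l k = truncatedCone l (fun j => k (i.succAbove j)) := by
  ext y
  refine and_congr_right fun _ => ⟨fun hy j => hy _, fun hy j => ?_⟩
  have hne : ∀ j, j ≠ i → k j y ≤ 0 := fun j hj => by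
    obtain ⟨j, rfl⟩ := Fin.exists_succAbove_eq hj
    exact hy j
  by_cases hj : j = i
  · subst hj; exact h y hne
  · exact hne j hj

lemma truncatedCone_replace {N : ℕ} (l : V →ₗ[ℝ] ℝ) (k : Fin N → V →ₗ[ℝ] ℝ) {i j : Fin N}
    (hij : i ≠ j) {a b : ℝ} (ha : 0 < a) (hb : b < 0) :
    truncatedCone l k ∩ {y | (a • k i + b • k j) y ≤ 0} =
      truncatedCone l (Function.update k i (a • k i + b • k j)) := by
  ext y
  simp only [truncatedCone, Set.mem_inter_iff, Set.mem_ofPred_eq, and_assoc]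
  refine and_congr_right fun _ => ⟨fun ⟨h1, h2⟩ m => ?_, fun h => ⟨fun m => ?_, ?_⟩⟩
  · by_cases hm : m = i
    · subst hm; simpa using h2
    · rw [Function.update_of_ne hm]; exact h1 m
  · have hi := h i
    have hj := h j
    rw [Function.update_self] at hi
    rw [Function.update_of_ne hij.symm] at hj
    by_cases hm : m = i
    · subst hm
      simp only [LinearMap.add_apply, LinearMap.smul_apply, smul_eq_mul] at hi
      nlinarith
    · have := h m
      rwa [Function.update_of_ne hm] at this
  · simpa using h i

lemma HyperplaneAdditive.eq_zero_truncatedCone [FiniteDimensional ℝ V] {F : Set V → ℝ}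
    (hF : HyperplaneAdditive F) (hlow : VanishesOnHyperplanes F)
    (hsimp : ∀ (m : ℕ) (v : Fin m → V), LinearIndependent ℝ v →
      F (convexHull ℝ (insert 0 (Set.range v))) = 0) (l : V →ₗ[ℝ] ℝ) (N : ℕ) :
    ∀ k : Fin N → V →ₗ[ℝ] ℝ, IsOriginPolytope (truncatedCone l k) →
      F (truncatedCone l k) = 0 := by
  classical
  induction N with
  | zero =>
    intro k hP
    obtain ⟨v, hv, e⟩ := truncatedCone_eq_convexHull l k (linearIndependent_empty_type) hP
    rw [e]
    exact hsimp 0 v hv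
  | succ N ih =>
    suffices h : ∀ (M : ℕ) (k : Fin (N + 1) → V →ₗ[ℝ] ℝ) (c : Fin (N + 1) → ℝ),
        (∑ i, c i • k i = 0) → (∃ i, c i ≠ 0) →
        (Finset.univ.filter fun i => c i ≠ 0).card = M →
        IsOriginPolytope (truncatedCone l k) → F (truncatedCone l k) = 0 by
      intro k hP
      by_cases hk : LinearIndependent ℝ k
      · obtain ⟨v, hv, e⟩ := truncatedCone_eq_convexHull l k hk hP
        rw [e]
        exact hsimp _ v hv
      · obtain ⟨c, hc, hne⟩ := Fintype.not_linearIndependent_iff.1 hk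
        exact h _ k c hc hne rfl hP
    intro M
    induction M using Nat.strong_induction_on with
    | _ M IH =>
    intro k c hc hne hM hP
    have hdrop : ∀ i, (∀ y, (∀ j, j ≠ i → k j y ≤ 0) → k i y ≤ 0) → F (truncatedCone l k) = 0 := by
      intro i hi
      have e := truncatedCone_drop l k i hi
      rw [e] at hP ⊢
      exact ih _ hP
    have hsgn : ∀ c' : Fin (N + 1) → ℝ, (∑ i, c' i • k i = 0) → (∃ i, c' i ≠ 0) →
        (∀ i, 0 ≤ c' i) → F (truncatedCone l k) = 0 := by
      rintro c' hc' ⟨i, hi⟩ hpos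
      by_cases hk0 : k i = 0
      · exact hdrop i fun y _ => by simp [hk0]
      · refine hlow _ hP (k i) hk0 fun y hy => ?_
        have hs : ∑ j, c' j * k j y = 0 := by
          have := congrArg (fun f : V →ₗ[ℝ] ℝ => f y) hc'
          simpa using this
        have := (Finset.sum_eq_zero_iff_of_nonpos (fun j _ =>
          mul_nonpos_of_nonneg_of_nonpos (hpos j) (hy.2 j))).1 hs i (Finset.mem_univ i)
        exact (mul_eq_zero.1 this).resolve_left hi
    by_cases hpos : ∃ i, 0 < c i
    swap
    · push Not at hpos
      exact hsgn (-c)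
        (by
          rw [← neg_zero, ← hc, ← Finset.sum_neg_distrib]
          exact Finset.sum_congr rfl fun i _ => by rw [Pi.neg_apply]; module) (by simpa using hne) (fun i => by simpa using hpos i)
    by_cases hneg : ∃ j, c j < 0
    swap
    · push Not at hneg
      exact hsgn c hc hne hneg
    obtain ⟨i, hi⟩ := hpos
    obtain ⟨j, hj⟩ := hneg
    have hij : i ≠ j := by rintro rfl; linarith
    by_cases hk' : c i • k i + c j • k j = 0
    · refine hdrop i fun y hy => ?_
      have h1 := hy j hij.symm
      have h2 := congrArg (fun f : V →ₗ[ℝ] ℝ => f y) hk'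
      simp only [LinearMap.add_apply, LinearMap.smul_apply, smul_eq_mul,
        LinearMap.zero_apply] at h2
      nlinarith
    have hsupp : ∀ (c' : Fin (N + 1) → ℝ) (m : Fin (N + 1)), c m ≠ 0 → c' m = 0 →
        (∀ q, c q = 0 → c' q = 0) → (Finset.univ.filter fun i => c' i ≠ 0).card < M := by
      intro c' m hm hm' hq
      rw [← hM]
      refine Finset.card_lt_card (Finset.ssubset_iff_subset_ne.2 ⟨fun q => ?_, fun e => ?_⟩)
      · simp only [Finset.mem_filter, Finset.mem_univ, true_and]
        exact fun h h' => h (hq q h')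
      · have : m ∈ Finset.univ.filter fun i => c' i ≠ 0 := by
          rw [e]; simpa using hm
        simp [hm'] at this
    have hsum : ∀ f : Fin (N + 1) → V →ₗ[ℝ] ℝ,
        ∑ q, f q = f i + f j + ∑ q ∈ (Finset.univ.erase i).erase j, f q := by
      intro f
      rw [← Finset.add_sum_erase _ f (Finset.mem_univ i),
        ← Finset.add_sum_erase _ f (Finset.mem_erase.2 ⟨hij.symm, Finset.mem_univ j⟩), add_assoc]
    have hrel : ∀ (k' : Fin (N + 1) → V →ₗ[ℝ] ℝ) (c' : Fin (N + 1) → ℝ),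
        (∀ q, q ≠ i → q ≠ j → c' q • k' q = c q • k q) →
        c' i • k' i + c' j • k' j = c i • k i + c j • k j → ∑ q, c' q • k' q = 0 := by
      intro k' c' h1 h2
      rw [hsum] at hc ⊢
      rw [h2, ← hc]
      congr 1
      refine Finset.sum_congr rfl fun q hq => ?_
      simp only [Finset.mem_erase] at hq
      exact h1 q hq.2.1 hq.1
    refine hF.eq_zero_of_halves hlow hP hk' ?_ ?_
    · have e := truncatedCone_replace l k hij hi hj
      have hP' := hP.inter_halfspace (c i • k i + c j • k j)
      rw [e] at hP' ⊢
      refine IH _ (hsupp (Function.update (Function.update c i 1) j 0) j hj.ne (by simp) ?_) _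
        (Function.update (Function.update c i 1) j 0) ?_ ⟨i, ?_⟩ rfl hP'
      · intro q hq
        by_cases hqj : q = j
        · subst hqj; simp
        · have hqi : q ≠ i := by rintro rfl; linarith
          simp [hqi, hqj, hq]
      · apply hrel
        · intro q hqi hqj
          simp [hqi, hqj]
        · simp [hij, hij.symm]
      · simp [hij]
    · have e := truncatedCone_replace l k hij.symm (neg_pos.2 hj) (neg_neg_of_pos hi)
      have hP' := hP.inter_halfspace_ge (c i • k i + c j • k j)
      have hset : {y | 0 ≤ (c i • k i + c j • k j) y} = {y | (-c j • k j + -c i • k i) y ≤ 0} := by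
        ext y
        simp only [Set.mem_ofPred_eq, LinearMap.add_apply, LinearMap.smul_apply, smul_eq_mul]
        constructor <;> intro h <;> linarith
      rw [hset, e] at hP' ⊢
      refine IH _ (hsupp (Function.update (Function.update c j (-1)) i 0) i hi.ne' (by simp) ?_) _
        (Function.update (Function.update c j (-1)) i 0) ?_ ⟨j, ?_⟩ rfl hP'
      · intro q hq
        by_cases hqi : q = i
        · subst hqi; simp
        · have hqj : q ≠ j := by rintro rfl; linarith
          simp [hqi, hqj, hq]
      · apply hrel
        · intro q hqi hqj
          simp [hqi, hqj]
        · simp only [Function.update_self, ne_eq, hij, hij.symm, not_false_eq_true,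
            Function.update_of_ne]
          module
      · simp [hij.symm]

lemma HyperplaneAdditive.eq_zero_of_vanishesOnHyperplanes [FiniteDimensional ℝ V] {F : Set V → ℝ}
    (hF : HyperplaneAdditive F) (hlow : VanishesOnHyperplanes F)
    (hsimp : ∀ (m : ℕ) (v : Fin m → V), LinearIndependent ℝ v →
      F (convexHull ℝ (insert 0 (Set.range v))) = 0) {P : Set V} (hP : IsOriginPolytope P) :
    F P = 0 := by
  classical
  obtain ⟨L, K, e⟩ := hP.exists_halfspaces
  suffices h : ∀ (M N : ℕ) (L : Finset (V →ₗ[ℝ] ℝ)) (k : Fin N → V →ₗ[ℝ] ℝ), L.card = M →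
      IsOriginPolytope {y | (∀ l ∈ L, l y ≤ 1) ∧ ∀ i, k i y ≤ 0} →
      F {y | (∀ l ∈ L, l y ≤ 1) ∧ ∀ i, k i y ≤ 0} = 0 by
    have e' : P = {y | (∀ l ∈ L, l y ≤ 1) ∧ ∀ i, (K.equivFin.symm i : V →ₗ[ℝ] ℝ) y ≤ 0} := by
      rw [e]
      ext y
      refine and_congr_right fun _ => ⟨fun h i => h _ (K.equivFin.symm i).2, fun h k hk => ?_⟩
      have := h (K.equivFin ⟨k, hk⟩)
      rwa [Equiv.symm_apply_apply] at this
    have := h L.card K.card L (fun i => (K.equivFin.symm i : V →ₗ[ℝ] ℝ)) rfl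
    rw [← e'] at this
    exact this hP
  intro M
  induction M with
  | zero =>
    intro N L k hL hP
    rw [Finset.card_eq_zero] at hL
    subst hL
    have e : {y : V | (∀ l ∈ (∅ : Finset (V →ₗ[ℝ] ℝ)), l y ≤ 1) ∧ ∀ i, k i y ≤ 0}
        = truncatedCone 0 k := by
      ext y; simp [truncatedCone]
    rw [e] at hP ⊢
    exact hF.eq_zero_truncatedCone hlow hsimp 0 N k hP
  | succ M IH =>
    intro N L k hL hP
    obtain ⟨l₁, hl₁⟩ : L.Nonempty := Finset.card_pos.1 (by omega)
    by_cases hM : M = 0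
    · subst hM
      obtain ⟨l, rfl⟩ := Finset.card_eq_one.1 hL
      have e : {y : V | (∀ m ∈ ({l} : Finset (V →ₗ[ℝ] ℝ)), m y ≤ 1) ∧ ∀ i, k i y ≤ 0}
          = truncatedCone l k := by
        ext y; simp [truncatedCone]
      rw [e] at hP ⊢
      exact hF.eq_zero_truncatedCone hlow hsimp l N k hP
    obtain ⟨l₂, hl₂⟩ : (L.erase l₁).Nonempty :=
      Finset.card_pos.1 (by rw [Finset.card_erase_of_mem hl₁]; omega)
    rw [Finset.mem_erase] at hl₂
    have hcut : ∀ l l' : V →ₗ[ℝ] ℝ, l ∈ L → l' ∈ L → l ≠ l' →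
        {y | (∀ l ∈ L, l y ≤ 1) ∧ ∀ i, k i y ≤ 0} ∩ {y | (l - l') y ≤ 0} =
          {y | (∀ m ∈ L.erase l, m y ≤ 1) ∧
            ∀ i, (Fin.cons (l - l') k : Fin (N + 1) → V →ₗ[ℝ] ℝ) i y ≤ 0} := by
      intro l l' hl hl' hne
      ext y
      simp only [Set.mem_inter_iff, Set.mem_ofPred_eq, Fin.forall_fin_succ, Fin.cons_zero,
        Fin.cons_succ, Finset.mem_erase]
      constructor
      · rintro ⟨⟨h1, h2⟩, h3⟩
        exact ⟨fun m hm => h1 m hm.2, h3, h2⟩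
      · rintro ⟨h1, h3, h2⟩
        refine ⟨⟨fun m hm => ?_, h2⟩, h3⟩
        by_cases hml : m = l
        · subst hml
          have := h1 l' ⟨hne.symm, hl'⟩
          rw [LinearMap.sub_apply] at h3
          linarith
        · exact h1 m ⟨hml, hm⟩
    refine hF.eq_zero_of_halves hlow hP (sub_ne_zero.2 hl₂.1) ?_ ?_
    · have e := hcut l₂ l₁ hl₂.2 hl₁ hl₂.1
      have hP' := hP.inter_halfspace (l₂ - l₁)
      rw [e] at hP' ⊢
      exact IH _ _ _ (by rw [Finset.card_erase_of_mem hl₂.2]; omega) hP'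
    · have e := hcut l₁ l₂ hl₁ hl₂.2 hl₂.1.symm
      have hP' := hP.inter_halfspace (l₁ - l₂)
      have hset : {y | 0 ≤ (l₂ - l₁) y} = {y | (l₁ - l₂) y ≤ 0} := by
        ext y; simp
      rw [e] at hP'
      rw [hset, e]
      exact IH _ _ _ (by rw [Finset.card_erase_of_mem hl₁]; omega) hP'

/-- A functional which is additive under cuts by hyperplanes through the origin and vanishes on the
simplices with a vertex at the origin vanishes on all polytopes containing the origin. -/
theorem HyperplaneAdditive.eq_zero [FiniteDimensional ℝ V] {F : Set V → ℝ}
    (hF : HyperplaneAdditive F)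
    (hsimp : ∀ (m : ℕ) (v : Fin m → V), LinearIndependent ℝ v →
      F (convexHull ℝ (insert 0 (Set.range v))) = 0) {P : Set V} (hP : IsOriginPolytope P) :
    F P = 0 := by
  induction h : Module.finrank ℝ V using Nat.strong_induction_on generalizing V with
  | _ d IH =>
  refine hF.eq_zero_of_vanishesOnHyperplanes (fun Q hQ k hk hQk => ?_) hsimp hP
  set W := LinearMap.ker k
  have hlt : Module.finrank ℝ W < d := by
    rw [← h]
    exact Submodule.finrank_lt (fun e => hk (LinearMap.ker_eq_top.1 e))
  have himg : ∀ R : Set V, (∀ y ∈ R, k y = 0) → W.subtype '' (W.subtype ⁻¹' R) = R := by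
    intro R hR
    rw [Set.image_preimage_eq_iff]
    exact fun y hy => ⟨⟨y, hR y hy⟩, rfl⟩
  have hpoly : IsOriginPolytope (W.subtype ⁻¹' Q) := by
    classical
    obtain ⟨⟨S, rfl⟩, h0⟩ := hQ
    refine ⟨⟨S.preimage W.subtype W.injective_subtype.injOn, ?_⟩, by simpa using h0⟩
    apply W.injective_subtype.image_injective
    rw [himg _ hQk, LinearMap.image_convexHull, Finset.coe_preimage,
      himg _ fun y hy => hQk y (subset_convexHull ℝ _ hy)]
  have := IH _ hlt (V := W) (F := fun R => F (W.subtype '' R)) ?_ ?_ hpoly rfl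
  · simpa only [himg Q hQk] using this
  · intro R hR g
    obtain ⟨g', hg'⟩ := LinearMap.exists_extend g
    have hval : ∀ y : W, g' (W.subtype y) = g y := fun y => by rw [← hg']; rfl
    have hset : ∀ p : ℝ → Prop, W.subtype '' (R ∩ {y | p (g y)})
        = W.subtype '' R ∩ {y | p (g' y)} := by
      intro p
      ext y
      constructor
      · rintro ⟨z, ⟨hz, hp⟩, rfl⟩
        exact ⟨⟨z, hz, rfl⟩, by rwa [Set.mem_ofPred_eq, hval]⟩
      · rintro ⟨⟨z, hz, rfl⟩, hp⟩
        exact ⟨z, ⟨hz, by rwa [Set.mem_ofPred_eq, hval] at hp⟩, rfl⟩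
    have := hF _ (hR.map W.subtype) g'
    rw [← hset (fun t => t = 0), ← hset (fun t => t ≤ 0), ← hset (fun t => 0 ≤ t)] at this
    exact this
  · intro m v hv
    have := hsimp m (W.subtype ∘ v) (hv.map' _ W.ker_subtype)
    rw [LinearMap.image_convexHull, Set.image_insert_eq, map_zero, ← Set.range_comp]
    exact this

end Vanishing

section Functionals

variable {n : ℕ}

/-- The properties of `P x ↦ h_{Z P}(x)^p`, for an `SL(n)` covariant `L_p` Minkowski valuation `Z`,
that are stable under linear combinations. -/
structure IsCovariantFunctional (p : ℝ) (f : Set (Euc n) → Euc n → ℝ) : Prop where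
  add (x : Euc n) : HyperplaneAdditive fun P => f P x
  cov (φ : Matrix.SpecialLinearGroup (Fin n) ℝ) (P : Set (Euc n)) (hP : IsOriginPolytope P)
    (x : Euc n) : f (matAct (φ : Matrix (Fin n) (Fin n) ℝ) P) x = f P (matVec (φ : Matrix (Fin n) (Fin n) ℝ)ᵀ x)
  cont (P : Set (Euc n)) (hP : IsOriginPolytope P) : Continuous (f P)
  homog (P : Set (Euc n)) (hP : IsOriginPolytope P) (t : ℝ) (ht : 0 ≤ t) (x : Euc n) :
    f P (t • x) = t ^ p * f P x

lemma matAct_mul (M N : Matrix (Fin n) (Fin n) ℝ) (P : Set (Euc n)) :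
    matAct (M * N) P = matAct M (matAct N P) := by
  simp only [matAct, ← Set.image_comp]
  congr 1
  ext x i
  simp [Matrix.toLpLin_apply, Matrix.mulVec_mulVec]

lemma IsOriginPolytope.matAct {P : Set (Euc n)} (hP : IsOriginPolytope P)
    (M : Matrix (Fin n) (Fin n) ℝ) : IsOriginPolytope (matAct M P) :=
  hP.map _

lemma IsOriginPolytope.smul {P : Set (Euc n)} (hP : IsOriginPolytope P) (t : ℝ) :
    IsOriginPolytope (t • P) :=
  hP.map (t • LinearMap.id)

lemma matAct_smul_set (M : Matrix (Fin n) (Fin n) ℝ) (t : ℝ) (P : Set (Euc n)) :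
    matAct M (t • P) = t • matAct M P :=
  Set.image_smul_comm _ _ _ fun y => map_smul _ t y

lemma matAct_smul (M : Matrix (Fin n) (Fin n) ℝ) (t : ℝ) (P : Set (Euc n)) :
    matAct (t • M) P = t • matAct M P := by
  simp only [matAct, ← Set.image_smul, ← Set.image_comp]
  congr 1
  ext x i
  simp

/-- The functional `f` conjugated by the homothety of determinant `s`. -/
def rescale (f : Set (Euc n) → Euc n → ℝ) (s : ℝ) (P : Set (Euc n)) (x : Euc n) : ℝ :=
  f (s ^ (1 / n : ℝ) • P) ((s ^ (1 / n : ℝ))⁻¹ • x)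

lemma rescale_rescale (f : Set (Euc n) → Euc n → ℝ) {s t : ℝ} (hs : 0 ≤ s) (ht : 0 ≤ t) :
    rescale (rescale f s) t = rescale f (s * t) := by
  ext P x
  simp only [rescale, Real.mul_rpow hs ht, smul_smul, mul_inv]

lemma smul_set_inter_halfspace (t : ℝ) (P : Set (Euc n)) (q q' : Euc n → Prop)
    (h : ∀ y, q' (t • y) ↔ q y) : t • (P ∩ {y | q y}) = t • P ∩ {y | q' y} := by
  ext y
  constructor
  · rintro ⟨z, ⟨hz, hq⟩, rfl⟩
    exact ⟨⟨z, hz, rfl⟩, (h z).2 hq⟩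
  · rintro ⟨⟨z, hz, rfl⟩, hq⟩
    exact ⟨z, ⟨hz, (h z).1 hq⟩, rfl⟩

lemma IsCovariantFunctional.rescale {p : ℝ} {f : Set (Euc n) → Euc n → ℝ}
    (hf : IsCovariantFunctional p f) {s : ℝ} (hs : 0 < s) :
    IsCovariantFunctional p (rescale f s) := by
  have ht : 0 < s ^ (1 / n : ℝ) := Real.rpow_pos_of_pos hs _
  refine ⟨fun x P hP k => ?_, fun φ P hP x => ?_, fun P hP => ?_, fun P hP t h x => ?_⟩
  · have := hf.add ((s ^ (1 / n : ℝ))⁻¹ • x) _ (hP.smul (s ^ (1 / n : ℝ))) k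
    simp only [_root_.rescale]
    rw [smul_set_inter_halfspace _ P _ (fun y => k y = 0),
      smul_set_inter_halfspace _ P _ (fun y => k y ≤ 0),
      smul_set_inter_halfspace _ P _ (fun y => 0 ≤ k y)]
    · exact this
    · intro y
      rw [map_smul, smul_eq_mul, mul_nonneg_iff_of_pos_left ht]
    · intro y
      rw [map_smul, smul_eq_mul, mul_nonpos_iff_pos_imp_nonpos]
      constructor
      · exact fun h => h.1 ht
      · exact fun h => ⟨fun _ => h, fun _ => ht.le⟩
    · intro y
      rw [map_smul, smul_eq_zero_iff_right ht.ne']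
  · simp only [_root_.rescale]
    rw [← matAct_smul_set, hf.cov φ _ (hP.smul _)]
    congr 1
    exact map_smul _ _ _
  · exact (hf.cont _ (hP.smul _)).comp (continuous_const_smul _)
  · simp only [_root_.rescale]
    rw [smul_comm, hf.homog _ (hP.smul _) t h]

lemma IsCovariantFunctional.matAct_eq {p : ℝ} {f : Set (Euc n) → Euc n → ℝ}
    (hf : IsCovariantFunctional p f) (hn : n ≠ 0) {M : Matrix (Fin n) (Fin n) ℝ} (hM : 0 < M.det)
    {P : Set (Euc n)} (hP : IsOriginPolytope P) (x : Euc n) :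
    f (matAct M P) x = _root_.rescale f M.det P (matVec Mᵀ x) := by
  set t := M.det ^ (1 / n : ℝ) with ht
  have ht0 : 0 < t := Real.rpow_pos_of_pos hM _
  have htn : t ^ n = M.det := by
    rw [ht, one_div, Real.rpow_inv_natCast_pow hM.le hn]
  have hdet : (t⁻¹ • M).det = 1 := by
    rw [Matrix.det_smul, Fintype.card_fin, inv_pow, htn, inv_mul_cancel₀ hM.ne']
  have := hf.cov ⟨t⁻¹ • M, hdet⟩ _ (hP.smul t) x
  rw [matAct_smul_set, matAct_smul, smul_smul, mul_inv_cancel₀ ht0.ne', one_smul] at this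
  rw [this, _root_.rescale, ← ht]
  congr 1
  simp [matVec]

/-- The face of the standard simplex spanned by the origin and the `e i`, `i ∉ Z`. -/
def stdFace (Z : Finset (Fin n)) : Set (Euc n) :=
  {y | (∀ i, 0 ≤ y i) ∧ ∑ i, y i ≤ 1 ∧ ∀ i ∈ Z, y i = 0}

lemma stdFace_eq_convexHull (Z : Finset (Fin n)) :
    stdFace Z = convexHull ℝ (insert 0 ((fun i => EuclideanSpace.single i (1 : ℝ)) '' {i | i ∉ Z})) := by
  classical
  apply Set.Subset.antisymm
  · intro y hy
    have h0 : (0 : Euc n) ∈ convexHull ℝ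
        (insert 0 ((fun i => EuclideanSpace.single i (1 : ℝ)) '' {i | i ∉ Z})) :=
      subset_convexHull _ _ (Set.mem_insert _ _)
    have := (convex_convexHull ℝ
      (insert 0 ((fun i => EuclideanSpace.single i (1 : ℝ)) '' {i | i ∉ Z}))).sum_mem
      (t := Finset.univ) (w := fun o : Option (Fin n) => o.elim (1 - ∑ i, y i) fun i => y i)
      (z := fun o => o.elim 0 fun i => if i ∈ Z then 0 else EuclideanSpace.single i (1 : ℝ))
      (by
        rintro (_ | i) -
        · simpa using hy.2.1
        · exact hy.1 i)
      (by simp [Fintype.sum_option])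
      (by
        rintro (_ | i) -
        · exact h0
        · by_cases hi : i ∈ Z
          · simpa [hi] using h0
          · simp only [Option.elim, hi, if_false]
            exact subset_convexHull _ _ (Set.mem_insert_of_mem _ ⟨i, hi, rfl⟩))
    convert this
    ext i
    simp only [Fintype.sum_option, Option.elim, smul_zero, zero_add, smul_ite]
    simp only [WithLp.ofLp_sum, Finset.sum_apply]
    rw [Finset.sum_eq_single i]
    · by_cases hi : i ∈ Z
      · simp [hi, hy.2.2 i hi]
      · simp [hi]
    · intro j _ hj
      by_cases hjZ : j ∈ Z
      · simp [hjZ]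
      · simp [hjZ, hj.symm]
    · simp
  · refine convexHull_min ?_ ?_
    · rintro _ (rfl | ⟨i, hi, rfl⟩)
      · simp [stdFace]
      · refine ⟨fun j => ?_, ?_, fun j hj => ?_⟩
        · simp only [PiLp.single_apply]
          split_ifs <;> norm_num
        · simp
        · have : j ≠ i := by rintro rfl; exact hi hj
          simp [this]
    · intro y hy z hz a b ha hb hab
      refine ⟨fun i => ?_, ?_, fun i hi => ?_⟩
      · have := hy.1 i
        have := hz.1 i
        simp only [PiLp.add_apply, PiLp.smul_apply, smul_eq_mul]
        positivity
      · simp only [PiLp.add_apply, PiLp.smul_apply, smul_eq_mul, Finset.sum_add_distrib,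
          ← Finset.mul_sum]
        nlinarith [hy.2.1, hz.2.1]
      · simp [hy.2.2 i hi, hz.2.2 i hi]

lemma isOriginPolytope_stdFace (Z : Finset (Fin n)) : IsOriginPolytope (stdFace Z) := by
  classical
  refine ⟨⟨insert 0 (Zᶜ.image fun i => EuclideanSpace.single i (1 : ℝ)), ?_⟩, by simp [stdFace]⟩
  rw [stdFace_eq_convexHull]
  congr 1
  ext y
  simp

/-- The value of `f` at a face of the standard simplex scaled to determinant `s`. -/
def faceValue (f : Set (Euc n) → Euc n → ℝ) (Z : Finset (Fin n)) (s : ℝ) (a : Fin n → ℝ) : ℝ :=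
  rescale f s (stdFace Z) (WithLp.toLp 2 a)

lemma IsCovariantFunctional.eq_faceValue {p : ℝ} {f : Set (Euc n) → Euc n → ℝ}
    (hf : IsCovariantFunctional p f) (hn : n ≠ 0) {M : Matrix (Fin n) (Fin n) ℝ} (hM : 0 < M.det)
    {s : ℝ} (hs : 0 < s) (Z : Finset (Fin n)) (a : Fin n → ℝ) :
    _root_.rescale f s (matAct M (stdFace Z)) (WithLp.toLp 2 a)
      = faceValue f Z (s * M.det) (Mᵀ *ᵥ a) := by
  rw [(hf.rescale hs).matAct_eq hn hM (isOriginPolytope_stdFace Z), rescale_rescale f hs.le hM.le]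
  rfl

lemma IsCovariantFunctional.continuous_faceValue {p : ℝ} {f : Set (Euc n) → Euc n → ℝ}
    (hf : IsCovariantFunctional p f) {s : ℝ} (hs : 0 < s) (Z : Finset (Fin n)) :
    Continuous (faceValue f Z s) :=
  ((hf.rescale hs).cont _ (isOriginPolytope_stdFace Z)).comp (PiLp.continuous_toLp 2 _)

lemma IsCovariantFunctional.faceValue_smul {p : ℝ} {f : Set (Euc n) → Euc n → ℝ}
    (hf : IsCovariantFunctional p f) {s : ℝ} (hs : 0 < s) (Z : Finset (Fin n)) {t : ℝ} (ht : 0 ≤ t)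
    (a : Fin n → ℝ) : faceValue f Z s (t • a) = t ^ p * faceValue f Z s a := by
  rw [faceValue, WithLp.toLp_smul, (hf.rescale hs).homog _ (isOriginPolytope_stdFace Z) t ht]
  rfl

lemma det_updateCol_one (j : Fin n) (b : Fin n → ℝ) :
    ((1 : Matrix (Fin n) (Fin n) ℝ).updateCol j b).det = b j := by
  rw [← Matrix.cramer_apply, Matrix.cramer_one]
  rfl

lemma updateCol_one_mulVec (j : Fin n) (b y : Fin n → ℝ) :
    (1 : Matrix (Fin n) (Fin n) ℝ).updateCol j b *ᵥ y = Function.update y j 0 + y j • b := by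
  ext k
  simp only [Matrix.mulVec, dotProduct, Matrix.updateCol_apply, Pi.add_apply, Pi.smul_apply,
    smul_eq_mul]
  rw [← Finset.add_sum_erase _ _ (Finset.mem_univ j), if_pos rfl]
  rw [Finset.sum_congr rfl (g := fun x => if x = k then Function.update y j 0 x else 0)]
  · by_cases hk : k = j
    · subst hk
      simp [mul_comm]
    · simp [hk, mul_comm, add_comm]
  · intro x hx
    simp only [Finset.mem_erase] at hx
    simp [hx.1, Matrix.one_apply, eq_comm]

lemma updateCol_one_transpose_mulVec (j : Fin n) (b a : Fin n → ℝ) :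
    ((1 : Matrix (Fin n) (Fin n) ℝ).updateCol j b)ᵀ *ᵥ a = Function.update a j (b ⬝ᵥ a) := by
  ext k
  rw [← Matrix.updateRow_transpose]
  by_cases hk : k = j
  · subst hk
    simp [Matrix.mulVec]
  · rw [Function.update_of_ne hk, Matrix.mulVec, Matrix.updateRow_ne hk, Matrix.transpose_one]
    exact congrFun (Matrix.one_mulVec a) k

lemma mem_matAct_iff (M : Matrix (Fin n) (Fin n) ℝ) (P : Set (Euc n)) (y : Euc n) :
    y ∈ matAct M P ↔ ∃ z, WithLp.toLp 2 z ∈ P ∧ M *ᵥ z = WithLp.ofLp y := by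
  constructor
  · rintro ⟨z, hz, rfl⟩
    exact ⟨WithLp.ofLp z, hz, rfl⟩
  · rintro ⟨z, hz, h⟩
    exact ⟨WithLp.toLp 2 z, hz, by ext i; simp [h]⟩

lemma matAct_updateCol_stdFace (Z : Finset (Fin n)) {m : Fin n} (hm : m ∈ Z) (b : Fin n → ℝ) :
    matAct ((1 : Matrix (Fin n) (Fin n) ℝ).updateCol m b) (stdFace Z) = stdFace Z := by
  have h : ∀ z : Fin n → ℝ, WithLp.toLp 2 z ∈ stdFace Z →
      (1 : Matrix (Fin n) (Fin n) ℝ).updateCol m b *ᵥ z = z := by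
    intro z hz
    have : z m = 0 := hz.2.2 m hm
    rw [updateCol_one_mulVec, this, zero_smul, add_zero, ← this, Function.update_eq_self]
  ext y
  rw [mem_matAct_iff]
  constructor
  · rintro ⟨z, hz, e⟩
    rw [h z hz] at e
    rwa [e] at hz
  · exact fun hy => ⟨WithLp.ofLp y, hy, h _ hy⟩

lemma sum_eq_sum_of_pair {i j : Fin n} (hij : i ≠ j) {y z : Fin n → ℝ} (h : y i + y j = z i + z j)
    (h' : ∀ k, k ≠ i → k ≠ j → y k = z k) : ∑ k, y k = ∑ k, z k := by
  have hsum : ∀ f : Fin n → ℝ,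
      ∑ k, f k = (f i + f j) + ∑ k ∈ (Finset.univ.erase i).erase j, f k := by
    intro f
    rw [← Finset.add_sum_erase _ f (Finset.mem_univ i),
      ← Finset.add_sum_erase _ f (Finset.mem_erase.2 ⟨hij.symm, Finset.mem_univ j⟩), add_assoc]
  rw [hsum y, hsum z, h]
  congr 1
  refine Finset.sum_congr rfl fun k hk => ?_
  simp only [Finset.mem_erase] at hk
  exact h' k hk.2.1 hk.1

/-- The vector `(1 - r) e i + r e j`. -/
def edgePoint (i j : Fin n) (r : ℝ) : Fin n → ℝ :=
  Function.update (Function.update 0 i (1 - r)) j r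

lemma mem_matAct_edgePoint_iff (P : Set (Euc n)) {i j : Fin n} (hij : i ≠ j) (r : ℝ) (y : Euc n) :
    y ∈ matAct ((1 : Matrix (Fin n) (Fin n) ℝ).updateCol j (edgePoint i j r)) P ↔
      ∃ z : Fin n → ℝ, WithLp.toLp 2 z ∈ P ∧ y i = z i + (1 - r) * z j ∧ y j = r * z j ∧
        ∀ k, k ≠ i → k ≠ j → y k = z k := by
  rw [mem_matAct_iff]
  simp only [updateCol_one_mulVec]
  refine exists_congr fun z => and_congr_right fun _ => ⟨fun e => ?_, fun ⟨hi, hj, hk⟩ => ?_⟩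
  · rw [← e]
    refine ⟨?_, ?_, fun k hki hkj => ?_⟩
    · simp [edgePoint, hij, mul_comm]
    · simp [edgePoint, mul_comm]
    · simp [edgePoint, hki, hkj]
  · ext k
    by_cases hkj : k = j
    · subst hkj
      simp [edgePoint, hj, mul_comm]
    by_cases hki : k = i
    · subst hki
      simp [edgePoint, hi, hij, mul_comm]
    · simp [edgePoint, hki, hkj, hk]

lemma edgePoint_swap {i j : Fin n} (hij : i ≠ j) (r : ℝ) :
    edgePoint j i (1 - r) = edgePoint i j r := by
  rw [edgePoint, edgePoint, Function.update_comm hij, sub_sub_cancel]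

lemma stdFace_inter_halfspace {Z : Finset (Fin n)} {i j : Fin n} (hij : i ≠ j) (hi : i ∉ Z)
    (hj : j ∉ Z) {r : ℝ} (h0 : 0 < r) (h1 : r < 1) :
    stdFace Z ∩ {y | 0 ≤ r * y i - (1 - r) * y j} =
      matAct ((1 : Matrix (Fin n) (Fin n) ℝ).updateCol j (edgePoint i j r)) (stdFace Z) := by
  ext y
  rw [mem_matAct_edgePoint_iff _ hij]
  constructor
  · rintro ⟨⟨hy0, hy1, hyZ⟩, hk⟩
    rw [Set.mem_ofPred_eq] at hk
    have hzi : y i - (1 - r) * (y j / r) = (r * y i - (1 - r) * y j) / r := by field_simp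
    set z := Function.update (Function.update (WithLp.ofLp y) i (y i - (1 - r) * (y j / r))) j
      (y j / r) with hz
    have zi : z i = y i - (1 - r) * (y j / r) := by simp [z, hij]
    have zj : z j = y j / r := by simp [z]
    have zk : ∀ k, k ≠ i → k ≠ j → y k = z k := fun k hki hkj => by simp [z, hki, hkj]
    have yj : y j = r * z j := by rw [zj]; field_simp
    have yi : y i = z i + (1 - r) * z j := by rw [zi, zj]; ring
    refine ⟨z, ⟨fun k => ?_, ?_, fun k hkZ => ?_⟩, yi, yj, zk⟩
    · change 0 ≤ z k
      by_cases hki : k = i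
      · rw [hki, zi, hzi]
        positivity
      by_cases hkj : k = j
      · rw [hkj, zj]
        exact div_nonneg (hy0 j) h0.le
      · rw [← zk k hki hkj]
        exact hy0 k
    · rwa [← sum_eq_sum_of_pair hij (y := WithLp.ofLp y) (by rw [yi, yj]; ring) zk]
    · change z k = 0
      rw [← zk k (by rintro rfl; exact hi hkZ) (by rintro rfl; exact hj hkZ)]
      exact hyZ k hkZ
  · rintro ⟨z, ⟨hz0, hz1, hzZ⟩, yi, yj, yk⟩
    simp only at hz0 hz1 hzZ
    refine ⟨⟨fun k => ?_, ?_, fun k hkZ => ?_⟩, ?_⟩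
    · by_cases hki : k = i
      · rw [hki, yi]
        have := mul_nonneg (sub_nonneg.2 h1.le) (hz0 j)
        linarith [hz0 i]
      by_cases hkj : k = j
      · rw [hkj, yj]
        exact mul_nonneg h0.le (hz0 j)
      · rw [yk k hki hkj]
        exact hz0 k
    · rwa [sum_eq_sum_of_pair hij (z := z) (by rw [yi, yj]; ring) yk]
    · rw [yk k (by rintro rfl; exact hi hkZ) (by rintro rfl; exact hj hkZ)]
      exact hzZ k hkZ
    · rw [Set.mem_ofPred_eq, yi, yj]
      have := mul_nonneg h0.le (hz0 i)
      linarith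

lemma stdFace_inter_hyperplane {Z : Finset (Fin n)} {i j : Fin n} (hij : i ≠ j) (hi : i ∉ Z)
    (hj : j ∉ Z) {r : ℝ} (h0 : 0 < r) (h1 : r < 1) :
    stdFace Z ∩ {y | r * y i - (1 - r) * y j = 0} =
      matAct ((1 : Matrix (Fin n) (Fin n) ℝ).updateCol i (edgePoint i j r))
        (stdFace (insert j Z)) := by
  have e : stdFace Z ∩ {y | r * y i - (1 - r) * y j = 0} =
      matAct ((1 : Matrix (Fin n) (Fin n) ℝ).updateCol i (edgePoint j i (1 - r))) (stdFace Z) ∩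
        {y | r * y i - (1 - r) * y j = 0} := by
    rw [← stdFace_inter_halfspace hij.symm hj hi (sub_pos.2 h1) (sub_lt_self 1 h0)]
    ext y
    simp only [Set.mem_inter_iff, Set.mem_ofPred_eq, and_assoc]
    refine and_congr_right fun _ => ⟨fun h => ⟨by linarith, h⟩, fun h => h.2⟩
  rw [e, ← edgePoint_swap hij]
  ext y
  rw [Set.mem_inter_iff, mem_matAct_edgePoint_iff _ hij.symm, mem_matAct_edgePoint_iff _ hij.symm]
  constructor
  · rintro ⟨⟨z, hz, yj, yi, yk⟩, h⟩
    refine ⟨z, ⟨hz.1, hz.2.1, fun k hk => ?_⟩, yj, yi, yk⟩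
    rcases Finset.mem_insert.1 hk with rfl | hk
    · rw [Set.mem_ofPred_eq, yi, yj] at h
      change z k = 0
      have : (1 - r) * z k = 0 := by linarith
      exact (mul_eq_zero.1 this).resolve_left (by linarith)
    · exact hz.2.2 k hk
  · rintro ⟨z, hz, yj, yi, yk⟩
    refine ⟨⟨z, ⟨hz.1, hz.2.1, fun k hk => hz.2.2 k (Finset.mem_insert_of_mem hk)⟩, yj, yi, yk⟩, ?_⟩
    have : z j = 0 := hz.2.2 j (Finset.mem_insert_self _ _)
    rw [Set.mem_ofPred_eq, yi, yj, this]
    ring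

lemma edgePoint_dotProduct {i j : Fin n} (hij : i ≠ j) (r : ℝ) (a : Fin n → ℝ) :
    edgePoint i j r ⬝ᵥ a = (1 - r) * a i + r * a j := by
  have : edgePoint i j r = Pi.single i (1 - r) + Pi.single j r := by
    ext k
    by_cases hkj : k = j
    · subst hkj
      simp [edgePoint, hij.symm]
    by_cases hki : k = i
    · subst hki
      simp [edgePoint, hij]
    · simp [edgePoint, hki, hkj]
  rw [this, add_dotProduct, single_dotProduct, single_dotProduct]

lemma IsCovariantFunctional.faceValue_split {p : ℝ} {f : Set (Euc n) → Euc n → ℝ}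
    (hf : IsCovariantFunctional p f) {Z : Finset (Fin n)} {i j : Fin n} (hij : i ≠ j) (hi : i ∉ Z)
    (hj : j ∉ Z) {r s : ℝ} (h0 : 0 < r) (h1 : r < 1) (hs : 0 < s) (a : Fin n → ℝ) {c : ℝ}
    (hc : c = (1 - r) * a i + r * a j) :
    faceValue f Z s a + faceValue f (insert j Z) (s * (1 - r)) (Function.update a i c) =
      faceValue f Z (s * r) (Function.update a j c) +
        faceValue f Z (s * (1 - r)) (Function.update a i c) := by
  have hn : n ≠ 0 := by rintro rfl; exact i.elim0
  have key := (hf.rescale hs).add (WithLp.toLp 2 a) _ (isOriginPolytope_stdFace Z)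
    (r • EuclideanSpace.projₗ i - (1 - r) • EuclideanSpace.projₗ j)
  have e2 : {y : Euc n | r * y i - (1 - r) * y j ≤ 0} =
      {y : Euc n | 0 ≤ (1 - r) * y j - (1 - (1 - r)) * y i} := by
    ext y
    simp only [Set.mem_ofPred_eq]
    constructor <;> intro h <;> linarith
  change _ + _root_.rescale f s (stdFace Z ∩ {y : Euc n | r * y i - (1 - r) * y j = 0}) _ =
    _root_.rescale f s (stdFace Z ∩ {y : Euc n | r * y i - (1 - r) * y j ≤ 0}) _ +
    _root_.rescale f s (stdFace Z ∩ {y : Euc n | 0 ≤ r * y i - (1 - r) * y j}) _ at key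
  rw [e2, stdFace_inter_halfspace hij hi hj h0 h1, stdFace_inter_hyperplane hij hi hj h0 h1,
    stdFace_inter_halfspace hij.symm hj hi (sub_pos.2 h1) (sub_lt_self 1 h0),
    edgePoint_swap hij] at key
  have dj : ((1 : Matrix (Fin n) (Fin n) ℝ).updateCol j (edgePoint i j r)).det = r := by
    rw [det_updateCol_one]; simp [edgePoint]
  have di : ((1 : Matrix (Fin n) (Fin n) ℝ).updateCol i (edgePoint i j r)).det = 1 - r := by
    rw [det_updateCol_one]; simp [edgePoint, hij]
  have dj' := dj.trans_gt h0
  have di' := di.trans_gt (sub_pos.2 h1)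
  rw [hf.eq_faceValue hn dj' hs, hf.eq_faceValue hn di' hs, hf.eq_faceValue hn di' hs, dj, di, updateCol_one_transpose_mulVec,
    updateCol_one_transpose_mulVec, edgePoint_dotProduct hij, ← hc] at key
  rw [add_comm (faceValue f Z (s * r) _)]
  exact key

lemma IsCovariantFunctional.faceValue_update {p : ℝ} {f : Set (Euc n) → Euc n → ℝ}
    (hf : IsCovariantFunctional p f) (hn : 2 ≤ n) {Z : Finset (Fin n)} {m : Fin n} (hm : m ∈ Z)
    {s t : ℝ} (hs : 0 < s) (ht : 0 < t) (a : Fin n → ℝ) (v : ℝ) :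
    faceValue f Z t (Function.update a m v) = faceValue f Z s a := by
  obtain ⟨i, hi⟩ : ∃ i : Fin n, i ≠ m :=
    haveI : Nontrivial (Fin n) := Fin.nontrivial_iff_two_le.2 hn
    exists_ne m
  have key : ∀ a : Fin n → ℝ, a i ≠ 0 →
      faceValue f Z t (Function.update a m v) = faceValue f Z s a := by
    intro a ha
    set b : Fin n → ℝ := Pi.single i ((v - t / s * a m) / a i) + Pi.single m (t / s) with hb
    have hbm : b m = t / s := by simp [b, hi.symm]
    have hdet : ((1 : Matrix (Fin n) (Fin n) ℝ).updateCol m b).det = t / s := by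
      rw [det_updateCol_one, hbm]
    have := hf.eq_faceValue (by omega) (hdet.symm ▸ div_pos ht hs) hs Z a
    rw [matAct_updateCol_stdFace Z hm, hdet, updateCol_one_transpose_mulVec,
      mul_div_cancel₀ _ hs.ne'] at this
    change _ = _root_.rescale f s (stdFace Z) (WithLp.toLp 2 a)
    rw [this]
    congr 2
    rw [hb, add_dotProduct, single_dotProduct, single_dotProduct]
    field_simp
    ring
  have hcont : ∀ {w : ℝ} (hw : 0 < w) (g : ℝ → Fin n → ℝ), Continuous g →
      Continuous fun u => faceValue f Z w (g u) :=
    fun hw g hg => (hf.continuous_faceValue hw Z).comp hg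
  have := Continuous.ext_on (dense_compl_singleton (0 : ℝ))
    (hcont ht (fun u => Function.update (Function.update a i u) m v) (by fun_prop))
    (hcont hs (fun u => Function.update a i u) (by fun_prop))
    (fun u hu => key _ (by simpa using hu))
  simpa using congrFun this (a i)

lemma IsCovariantFunctional.faceValue_congr {p : ℝ} {f : Set (Euc n) → Euc n → ℝ}
    (hf : IsCovariantFunctional p f) (hn : 2 ≤ n) {Z : Finset (Fin n)} (hZ : Z.Nonempty)
    {s t : ℝ} (hs : 0 < s) (ht : 0 < t) {a a' : Fin n → ℝ} (h : ∀ i ∉ Z, a i = a' i) :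
    faceValue f Z s a = faceValue f Z t a' := by
  classical
  obtain ⟨m, hm⟩ := hZ
  have key : ∀ T ⊆ Z, faceValue f Z s a = faceValue f Z s (T.piecewise a' a) := by
    intro T
    induction T using Finset.induction_on with
    | empty => simp
    | insert i T hi ih =>
      intro hT
      rw [Finset.piecewise_insert,
        hf.faceValue_update hn (hT (Finset.mem_insert_self _ _)) hs hs]
      exact ih fun x hx => hT (Finset.mem_insert_of_mem hx)
  rw [key Z subset_rfl, ← hf.faceValue_update hn hm hs ht _ (a' m)]
  congr 1
  ext k
  by_cases hk : k = m
  · subst hk; simp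
  · rw [Function.update_of_ne hk]
    by_cases hkZ : k ∈ Z
    · simp [hkZ]
    · simp [hkZ, h]

lemma IsCovariantFunctional.faceValue_univ {p : ℝ} {f : Set (Euc n) → Euc n → ℝ}
    (hp : 0 < p) (hf : IsCovariantFunctional p f) (hn : 2 ≤ n) {s : ℝ} (hs : 0 < s) (a : Fin n → ℝ) :
    faceValue f Finset.univ s a = 0 := by
  rw [hf.faceValue_congr hn ⟨⟨0, by omega⟩, Finset.mem_univ _⟩ hs hs (a' := (0 : ℝ) • a) (by simp),
    hf.faceValue_smul hs _ le_rfl, Real.zero_rpow hp.ne', zero_mul]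

lemma IsCovariantFunctional.faceValue_insert {p : ℝ} {f : Set (Euc n) → Euc n → ℝ}
    (hf : IsCovariantFunctional p f) (hn : 2 ≤ n) {Z : Finset (Fin n)} (hZ : Z.Nonempty)
    {i j : Fin n} (hij : i ≠ j) (hi : i ∉ Z) {a : Fin n → ℝ} (ha : a i = a j) {s t : ℝ}
    (hs : 0 < s) (ht : 0 < t) :
    faceValue f (insert j Z) s a = faceValue f Z t a := by
  by_cases hj : j ∈ Z
  · rw [Finset.insert_eq_of_mem hj]
    exact hf.faceValue_congr hn hZ hs ht fun _ _ => rfl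
  have := hf.faceValue_split hij hi hj (r := 1 / 2) (by norm_num) (by norm_num) ht a (c := a i)
    (by rw [← ha]; ring)
  rw [Function.update_eq_self, ha, Function.update_eq_self,
    hf.faceValue_congr hn hZ (a := a) (a' := a) (by positivity : 0 < t * (1 - 1 / 2)) ht (fun _ _ => rfl),
    hf.faceValue_congr hn hZ (a := a) (a' := a) (by positivity : 0 < t * (1 / 2)) ht (fun _ _ => rfl),
    hf.faceValue_congr hn (Finset.insert_nonempty _ _) (a := a) (a' := a)
      (by positivity : 0 < t * (1 - 1 / 2)) hs (fun _ _ => rfl)] at this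
  linarith

lemma IsCovariantFunctional.faceValue_eq_of_subset {p : ℝ} {f : Set (Euc n) → Euc n → ℝ}
    (hf : IsCovariantFunctional p f) (hn : 2 ≤ n) {Z Z' : Finset (Fin n)} (hZ : Z.Nonempty)
    (hZZ' : Z ⊆ Z') {a : Fin n → ℝ} (ha : ∀ j ∈ Z', j ∉ Z → ∃ i ∉ Z', a i = a j) {s t : ℝ}
    (hs : 0 < s) (ht : 0 < t) :
    faceValue f Z s a = faceValue f Z' t a := by
  classical
  suffices h : ∀ T : Finset (Fin n), T ⊆ Z' → T ∩ Z = ∅ →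
      faceValue f Z s a = faceValue f (T ∪ Z) s a by
    rw [h (Z' \ Z) Finset.sdiff_subset (by simp), Finset.sdiff_union_of_subset hZZ']
    exact hf.faceValue_congr hn (hZ.mono hZZ') hs ht fun _ _ => rfl
  intro T
  induction T using Finset.induction_on with
  | empty => simp
  | insert j T hj ih =>
    intro hT hTZ
    have hjZ : j ∉ Z := fun h => by
      have : j ∈ insert j T ∩ Z := Finset.mem_inter.2 ⟨Finset.mem_insert_self _ _, h⟩
      simp [hTZ] at this
    have hT' : T ⊆ Z' := fun x hx => hT (Finset.mem_insert_of_mem hx)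
    obtain ⟨i, hi, hia⟩ := ha j (hT (Finset.mem_insert_self _ _)) hjZ
    rw [Finset.insert_union, hf.faceValue_insert hn (hZ.mono Finset.subset_union_right)
      (i := i) (by rintro rfl; exact hi (hT (Finset.mem_insert_self _ _))) _ hia hs hs]
    · refine ih hT' (Finset.subset_empty.1 ?_)
      rw [← hTZ]
      exact Finset.inter_subset_inter_right (Finset.subset_insert _ _)
    · simp only [Finset.mem_union, not_or]
      exact ⟨fun h => hi (hT' h), fun h => hi (hZZ' h)⟩

end Functionals

section FunctionalEquations

variable {n : ℕ} {p : ℝ} {f : Set (Euc n) → Euc n → ℝ}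

/-- An additive function on the positive reals that is bounded below is linear. -/
lemma linear_of_additive_of_boundedBelow {X : ℝ → ℝ}
    (hadd : ∀ u v, 0 < u → 0 < v → X (u + v) = X u + X v) {C : ℝ} (hC : ∀ u, 0 < u → -C ≤ X u) :
    0 ≤ X 1 ∧ ∀ s, 0 < s → X s = s * X 1 := by
  have nat_mul : ∀ Y : ℝ → ℝ, (∀ u v, 0 < u → 0 < v → Y (u + v) = Y u + Y v) →
      ∀ N : ℕ, ∀ u, 0 < u → Y ((N + 1) * u) = (N + 1) * Y u := by
    intro Y hY N u hu
    induction N with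
    | zero => simp
    | succ N ih =>
      push_cast
      rw [add_one_mul (N + 1 : ℝ) u, hY _ _ (by positivity) hu, ih]
      ring
  have nonneg : ∀ Y : ℝ → ℝ, (∀ u v, 0 < u → 0 < v → Y (u + v) = Y u + Y v) →
      ∀ C, (∀ u, 0 < u → -C ≤ Y u) → ∀ u, 0 < u → 0 ≤ Y u := by
    intro Y hY C hC u hu
    by_contra! h
    obtain ⟨N, hN⟩ := exists_nat_gt (C / -Y u)
    rw [div_lt_iff₀ (neg_pos.2 h)] at hN
    have := hC ((N + 1) * u) (by positivity)
    rw [nat_mul Y hY N u hu] at this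
    linarith
  have h1 := nonneg X hadd C hC
  refine ⟨h1 1 one_pos, fun s hs => ?_⟩
  set Y : ℝ → ℝ := fun u => X u - u * X 1 with hYdef
  have hY : ∀ u v, 0 < u → 0 < v → Y (u + v) = Y u + Y v := by
    intro u v hu hv
    simp only [Y, hadd u v hu hv]
    ring
  have hY1 : Y 1 = 0 := by simp [Y]
  have hYN : ∀ N : ℕ, Y (N + 1) = 0 := by
    intro N
    have := nat_mul Y hY N 1 one_pos
    rwa [mul_one, hY1, mul_zero] at this
  have hYper : ∀ (N : ℕ) (u : ℝ), 0 < u → Y (u + N) = Y u := by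
    intro N u hu
    induction N with
    | zero => simp
    | succ N ih => rw [Nat.cast_succ, ← add_assoc, hY _ _ (by positivity) one_pos, ih, hY1, add_zero]
  have hYb : ∀ u, 0 < u → -X 1 ≤ Y u := by
    intro u hu
    have hceil : 0 < ⌈u⌉₊ := Nat.ceil_pos.2 hu
    obtain ⟨N, hN⟩ : ∃ N, ⌈u⌉₊ = N + 1 := ⟨⌈u⌉₊ - 1, by omega⟩
    have h2 : (N : ℝ) < u := Nat.lt_ceil.1 (by omega)
    have h3 : u ≤ N + 1 := by
      have := Nat.le_ceil u
      rw [hN] at this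
      exact_mod_cast this
    have h4 := hYper N (u - N) (by linarith)
    rw [sub_add_cancel] at h4
    rw [h4]
    have := h1 (u - N) (by linarith)
    have := h1 1 one_pos
    simp only [Y]
    nlinarith
  have h5 := nonneg Y hY _ hYb
  obtain ⟨N, hN⟩ := exists_nat_gt s
  have h6 := hY s (N + 1 - s) hs (by linarith)
  rw [add_sub_cancel, hYN] at h6
  have h7 := h5 s hs
  have h8 := h5 (N + 1 - s) (by linarith)
  have : Y s = 0 := by linarith
  simp only [Y] at this
  linarith

lemma exists_ratio {x y c : ℝ} (h : 0 < (c - x) * (y - c)) :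
    ∃ r, 0 < r ∧ r < 1 ∧ c = (1 - r) * x + r * y := by
  rcases pos_and_pos_or_neg_and_neg_of_mul_pos h with ⟨h1, h2⟩ | ⟨h1, h2⟩
  · refine ⟨(c - x) / (y - x), div_pos h1 (by linarith), ?_, ?_⟩
    · rw [div_lt_one (by linarith)]
      linarith
    · have : y - x ≠ 0 := by linarith
      field_simp
      ring
  · refine ⟨(x - c) / (x - y), div_pos (by linarith) (by linarith), ?_, ?_⟩
    · rw [div_lt_one (by linarith)]
      linarith
    · have : x - y ≠ 0 := by linarith
      field_simp
      ring

lemma exists_monotone_triple {ι : Type} (a : ι → ℝ) (q : ι → Prop) {x y z : ι} (hx : q x) (hy : q y)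
    (hz : q z) (hxy : x ≠ y) (hxz : x ≠ z) (hyz : y ≠ z) :
    ∃ i l j, q i ∧ q l ∧ q j ∧ i ≠ l ∧ i ≠ j ∧ l ≠ j ∧ a i ≤ a l ∧ a l ≤ a j := by
  rcases le_total (a x) (a y) with h1 | h1 <;> rcases le_total (a y) (a z) with h2 | h2 <;>
    rcases le_total (a x) (a z) with h3 | h3
  · exact ⟨x, y, z, hx, hy, hz, hxy, hxz, hyz, h1, h2⟩
  · exact ⟨x, y, z, hx, hy, hz, hxy, hxz, hyz, h1, h2⟩
  · exact ⟨x, z, y, hx, hz, hy, hxz, hxy, hyz.symm, h3, h2⟩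
  · exact ⟨z, x, y, hz, hx, hy, hxz.symm, hyz.symm, hxy, h3, h1⟩
  · exact ⟨y, x, z, hy, hx, hz, hxy.symm, hyz, hxz, h1, h3⟩
  · exact ⟨y, z, x, hy, hz, hx, hyz, hxy.symm, hxz.symm, h2, h3⟩
  · exact ⟨z, y, x, hz, hy, hx, hyz.symm, hxz.symm, hxy.symm, h2, h1⟩
  · exact ⟨z, y, x, hz, hy, hx, hyz.symm, hxz.symm, hxy.symm, h2, h1⟩

lemma IsCovariantFunctional.faceValue_eq_zero_of_pairs (hf : IsCovariantFunctional p f) (hn : 2 ≤ n)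
    (h2 : ∀ Z : Finset (Fin n), Z.Nonempty → Zᶜ.card ≤ 2 → ∀ s, 0 < s → ∀ a, faceValue f Z s a = 0)
    {Z : Finset (Fin n)} (hZ : Z.Nonempty) {s : ℝ} (hs : 0 < s) (a : Fin n → ℝ) :
    faceValue f Z s a = 0 := by
  induction h : Zᶜ.card using Nat.strong_induction_on generalizing Z s a with
  | _ N ih =>
  by_cases hN : N ≤ 2
  · exact h2 Z hZ (h ▸ hN) s hs a
  obtain ⟨x, y, z, hx, hy, hz, hxy, hxz, hyz⟩ := Finset.two_lt_card_iff.1 (h ▸ not_le.1 hN)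
  simp only [Finset.mem_compl] at hx hy hz
  obtain ⟨i, l, j, hi, hl, hj, hil, hij, hlj, h1, h2⟩ :=
    exists_monotone_triple a (· ∉ Z) hx hy hz hxy hxz hyz
  have hins : ∀ k ∉ Z, ∀ t, 0 < t → ∀ b, faceValue f (insert k Z) t b = 0 := by
    intro k hk t ht b
    refine ih (insert k Z)ᶜ.card ?_ (Finset.insert_nonempty _ _) ht b rfl
    rw [← h, Finset.compl_insert]
    exact Finset.card_erase_lt_of_mem (Finset.mem_compl.2 hk)
  have hdup : ∀ k k', k ≠ k' → k ∉ Z → k' ∉ Z → ∀ t, 0 < t → ∀ b : Fin n → ℝ, b k = b k' →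
      faceValue f Z t b = 0 := by
    intro k k' hkk' hk hk' t ht b hb
    rw [← hf.faceValue_insert hn hZ hkk' hk hb one_pos ht]
    exact hins k' hk' 1 one_pos b
  rcases h1.eq_or_lt with h1 | h1
  · exact hdup i l hil hi hl s hs a h1
  rcases h2.eq_or_lt with h2 | h2
  · exact hdup l j hlj hl hj s hs a h2
  obtain ⟨r, h0, h1', hc⟩ := exists_ratio (mul_pos (sub_pos.2 h1) (sub_pos.2 h2))
  have := hf.faceValue_split hij hi hj h0 h1' hs a hc
  rwa [hins j hj _ (mul_pos hs (sub_pos.2 h1')), hdup l j hlj hl hj _ (mul_pos hs h0),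
    hdup i l hil hi hl _ (mul_pos hs (sub_pos.2 h1')), add_zero, add_zero] at this
  · simp [hil.symm]
  · simp [hlj]

lemma IsCovariantFunctional.faceValue_empty_of_eq (hf : IsCovariantFunctional p f) (hn : 2 ≤ n)
    {i j : Fin n} (hij : i ≠ j) {a : Fin n → ℝ} (ha : a i = a j) {C : ℝ}
    (hC : ∀ s, 0 < s → -C ≤ faceValue f ∅ s a) :
    ∃ w, 0 ≤ w ∧ ∀ s, 0 < s → faceValue f ∅ s a = faceValue f {j} 1 a + s * w := by
  have := linear_of_additive_of_boundedBelow (X := fun s => faceValue f ∅ s a - faceValue f {j} 1 a)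
    (C := C + faceValue f {j} 1 a) ?_ ?_
  · refine ⟨_, this.1, fun s hs => ?_⟩
    rw [← this.2 s hs]
    ring
  · intro u v hu hv
    have h := hf.faceValue_split hij (Finset.notMem_empty i) (Finset.notMem_empty j)
      (r := v / (u + v)) (by positivity) (by rw [div_lt_one (by positivity)]; linarith)
      (add_pos hu hv) a (c := a i) (by rw [← ha]; ring)
    have e1 : (u + v) * (v / (u + v)) = v := by field_simp
    have e2 : (u + v) * (1 - v / (u + v)) = u := by field_simp; ring
    rw [Function.update_eq_self, ha, Function.update_eq_self, e1, e2,
      hf.faceValue_congr hn (Finset.insert_nonempty _ _) (a := a) (a' := a) hu one_pos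
        (fun _ _ => rfl), LawfulSingleton.insert_empty_eq] at h
    linarith
  · intro u hu
    linarith [hC u hu]

lemma IsCovariantFunctional.faceValue_empty_linear (hf : IsCovariantFunctional p f) (hn : 3 ≤ n)
    (h0 : ∀ Z : Finset (Fin n), Z.Nonempty → ∀ s, 0 < s → ∀ a, faceValue f Z s a = 0)
    (hC : ∀ a, ∃ C, ∀ s, 0 < s → -C ≤ faceValue f ∅ s a) {s : ℝ} (hs : 0 < s) (a : Fin n → ℝ) :
    faceValue f ∅ s a = s * faceValue f ∅ 1 a := by
  have hdup : ∀ (i j : Fin n), i ≠ j → ∀ a : Fin n → ℝ, a i = a j → ∀ t, 0 < t →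
      faceValue f ∅ t a = t * faceValue f ∅ 1 a := by
    intro i j hij a ha t ht
    obtain ⟨C, hC⟩ := hC a
    obtain ⟨w, -, hw⟩ := hf.faceValue_empty_of_eq (by omega) hij ha hC
    rw [hw t ht, hw 1 one_pos, h0 _ (Finset.singleton_nonempty _) 1 one_pos]
    ring
  obtain ⟨i, l, j, -, -, -, hil, hij, hlj, h1, h2⟩ := exists_monotone_triple a (fun _ => True)
    (x := ⟨0, by omega⟩) (y := ⟨1, by omega⟩) (z := ⟨2, by omega⟩) trivial trivial trivial
    (by simp) (by simp) (by simp)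
  rcases h1.eq_or_lt with h1 | h1
  · exact hdup i l hil a h1 s hs
  rcases h2.eq_or_lt with h2 | h2
  · exact hdup l j hlj a h2 s hs
  obtain ⟨r, hr0, hr1, hc⟩ := exists_ratio (mul_pos (sub_pos.2 h1) (sub_pos.2 h2))
  have key : ∀ t, 0 < t → faceValue f ∅ t a =
      t * (r * faceValue f ∅ 1 (Function.update a j (a l)) +
        (1 - r) * faceValue f ∅ 1 (Function.update a i (a l))) := by
    intro t ht
    have := hf.faceValue_split hij (Finset.notMem_empty i) (Finset.notMem_empty j) hr0 hr1 ht a hc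
    rw [h0 _ (Finset.insert_nonempty _ _) _ (mul_pos ht (sub_pos.2 hr1)),
      hdup l j hlj _ (by simp [hlj]) _ (mul_pos ht hr0),
      hdup i l hil _ (by simp [hil.symm]) _ (mul_pos ht (sub_pos.2 hr1))] at this
    linarith
  rw [key s hs, key 1 one_pos, one_mul]

lemma IsCovariantFunctional.faceValue_empty_eq_zero (hf : IsCovariantFunctional p f)
    (hp : 0 < p)
    (h0 : ∀ Z : Finset (Fin n), Z.Nonempty → ∀ s, 0 < s → ∀ a, faceValue f Z s a = 0)
    (hlin : ∀ s, 0 < s → ∀ a, faceValue f ∅ s a = s * faceValue f ∅ 1 a)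
    (hpos : ∀ i, faceValue f ∅ 1 (Pi.single i 1) = 0)
    (hneg : ∀ i, faceValue f ∅ 1 (Pi.single i (-1)) = 0) {s : ℝ} (hs : 0 < s) (a : Fin n → ℝ) :
    faceValue f ∅ s a = 0 := by
  classical
  rw [hlin s hs, mul_eq_zero]
  right
  have split : ∀ (a : Fin n → ℝ) (i j : Fin n) (c : ℝ), i ≠ j → 0 < (c - a i) * (a j - c) →
      ∃ r, 0 < r ∧ r < 1 ∧ faceValue f ∅ 1 a =
        r * faceValue f ∅ 1 (Function.update a j c) +
          (1 - r) * faceValue f ∅ 1 (Function.update a i c) := by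
    intro a i j c hij h
    obtain ⟨r, hr0, hr1, hc⟩ := exists_ratio h
    refine ⟨r, hr0, hr1, ?_⟩
    have := hf.faceValue_split hij (Finset.notMem_empty i) (Finset.notMem_empty j) hr0 hr1 one_pos a hc
    rw [h0 _ (Finset.insert_nonempty _ _) _ (by linarith), one_mul, one_mul, hlin r hr0,
      hlin (1 - r) (by linarith)] at this
    linarith
  have zero_val : faceValue f ∅ 1 (0 : Fin n → ℝ) = 0 := by
    have := hf.faceValue_smul one_pos ∅ le_rfl (0 : Fin n → ℝ)
    rwa [smul_zero, Real.zero_rpow hp.ne', zero_mul] at this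
  have single_val : ∀ (i : Fin n) (t : ℝ), faceValue f ∅ 1 (Pi.single i t) = 0 := by
    intro i t
    rcases le_total 0 t with ht | ht
    · have := hf.faceValue_smul one_pos ∅ ht (Pi.single i (1 : ℝ))
      rwa [hpos, mul_zero, ← Pi.single_smul, smul_eq_mul, mul_one] at this
    · have := hf.faceValue_smul one_pos ∅ (neg_nonneg.2 ht) (Pi.single i (-1 : ℝ))
      rwa [hneg, mul_zero, ← Pi.single_smul, smul_eq_mul, neg_mul_neg, mul_one] at this
  have distinct : ∀ (N : ℕ) (a : Fin n → ℝ), (Finset.univ.filter fun i => a i ≠ 0).card = N →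
      (∀ i j, i ≠ j → a i ≠ 0 → a i ≠ a j) → faceValue f ∅ 1 a = 0 := by
    intro N
    induction N with
    | zero =>
      intro a ha _
      rw [Finset.card_eq_zero, Finset.filter_eq_empty_iff] at ha
      have : a = 0 := by
        ext i
        simpa using ha (Finset.mem_univ i)
      rw [this, zero_val]
    | succ N ih =>
      intro a ha hd
      obtain ⟨i, hi⟩ : ∃ i, a i ≠ 0 := by
        by_contra! h
        simp [h] at ha
      have hcard : ∀ j, a j ≠ 0 →
          (Finset.univ.filter fun k => Function.update a j 0 k ≠ 0).card = N := by
        intro j hj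
        have : (Finset.univ.filter fun k => Function.update a j 0 k ≠ 0) =
            (Finset.univ.filter fun k => a k ≠ 0).erase j := by
          ext k
          by_cases hk : k = j
          · subst hk; simp
          · simp [hk]
        rw [this, Finset.card_erase_of_mem (by simpa using hj), ha]
        rfl
      have hdist : ∀ j, ∀ k k', k ≠ k' → Function.update a j 0 k ≠ 0 →
          Function.update a j 0 k ≠ Function.update a j 0 k' := by
        intro j k k' hkk' hk
        have hkj : k ≠ j := by rintro rfl; simp at hk
        rw [Function.update_of_ne hkj] at hk ⊢
        by_cases hkj' : k' = j
        · subst hkj'; simpa using hk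
        · rw [Function.update_of_ne hkj']
          exact hd k k' hkk' hk
      have hzero : ∀ j, a j ≠ 0 → faceValue f ∅ 1 (Function.update a j 0) = 0 := fun j hj =>
        ih _ (hcard j hj) (hdist j)
      by_cases hex : ∃ j, j ≠ i ∧ a j ≠ 0
      swap
      · push Not at hex
        have : a = Pi.single i (a i) := by
          ext k
          by_cases hk : k = i
          · subst hk; simp
          · simp [hk, hex k hk]
        rw [this, single_val]
      obtain ⟨j, hji, hj⟩ := hex
      rcases (mul_ne_zero hi hj).lt_or_gt with h | h
      · obtain ⟨r, -, -, e⟩ := split a i j 0 hji.symm (by linarith)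
        rw [e, hzero i hi, hzero j hj, mul_zero, mul_zero, add_zero]
      · have hne : a j ≠ a i := hd j i hji hj
        have hmain : ∀ i j, j ≠ i → a i ≠ 0 → a j ≠ 0 → 0 < a i * (a j - a i) →
            faceValue f ∅ 1 a = 0 := by
          intro i j hji hi hj hlt
          obtain ⟨r, -, hr1, e⟩ := split (Function.update a i 0) i j (a i) hji.symm
            (by simpa [hji] using hlt)
          have hsw : faceValue f ∅ 1 (Function.update (Function.update a i 0) j (a i)) = 0 := by
            have hval : ∀ k, Function.update (Function.update a i 0) j (a i) k =
                Function.update a j 0 (Equiv.swap i j k) := by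
              intro k
              by_cases hkj : k = j
              · subst hkj; simp [hji.symm]
              by_cases hki : k = i
              · subst hki; simp [hji.symm]
              · simp [hkj, hki, Equiv.swap_apply_of_ne_of_ne hki hkj]
            refine ih _ ?_ ?_
            · rw [← hcard j hj]
              refine Finset.card_bij (fun k _ => Equiv.swap i j k) ?_ ?_ ?_
              · intro k hk
                simpa [hval] using hk
              · intro k _ k' _ hkk
                exact (Equiv.swap i j).injective hkk
              · intro k hk
                exact ⟨Equiv.swap i j k, by simpa [hval] using hk, by simp⟩
            · intro k k' hkk' hk
              rw [hval] at hk ⊢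
              rw [hval]
              exact hdist j _ _ (fun h => hkk' ((Equiv.swap i j).injective h)) hk
          rw [hzero i hi, hsw, Function.update_idem, Function.update_eq_self, mul_zero,
            zero_add] at e
          exact (mul_eq_zero.1 e.symm).resolve_left (by linarith)
        rcases lt_or_gt_of_ne hi with hi' | hi' <;> rcases lt_or_gt_of_ne hne with hlt | hlt
        · exact hmain i j hji hi hj (by nlinarith)
        · exact hmain j i hji.symm hj hi (by nlinarith)
        · exact hmain j i hji.symm hj hi (by nlinarith)
        · exact hmain i j hji hi hj (by nlinarith)
  set g : ℝ → Fin n → ℝ := fun ε k => a k + ε * (k : ℕ) with hg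
  have hcont : Continuous fun ε => faceValue f ∅ 1 (g ε) :=
    (hf.continuous_faceValue one_pos ∅).comp (by fun_prop)
  have hlim : Tendsto (fun ε => faceValue f ∅ 1 (g ε)) (nhdsWithin 0 (Set.Ioi 0))
      (nhds (faceValue f ∅ 1 (g 0))) := hcont.continuousAt.continuousWithinAt
  have hev : ∀ᶠ ε in nhdsWithin (0 : ℝ) (Set.Ioi 0), ∀ i j : Fin n, i ≠ j → g ε i ≠ g ε j := by
    refine eventually_all.2 fun i => eventually_all.2 fun j => ?_
    by_cases hij : i = j
    · exact Eventually.of_forall fun _ h => absurd hij h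
    by_cases haij : a i = a j
    · filter_upwards [self_mem_nhdsWithin] with ε hε _
      simp only [g, haij, ne_eq, add_right_inj, mul_eq_mul_left_iff, Nat.cast_inj, not_or]
      exact ⟨fun h => hij (Fin.ext h), (Set.mem_Ioi.1 hε).ne'⟩
    · have h1 : ContinuousAt (fun ε : ℝ => g ε i - g ε j) 0 := by
        apply Continuous.continuousAt
        fun_prop
      have := (h1.eventually_ne (y := 0) (by simpa [g, sub_eq_zero] using haij)).filter_mono
        (nhdsWithin_le_nhds (s := Set.Ioi 0))
      filter_upwards [this] with ε hε _
      exact sub_ne_zero.1 hε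
  have hzero : Tendsto (fun ε => faceValue f ∅ 1 (g ε)) (nhdsWithin 0 (Set.Ioi 0)) (nhds 0) := by
    refine tendsto_const_nhds.congr' ?_
    filter_upwards [hev] with ε hε
    exact (distinct _ _ rfl fun i j hij _ => hε i j hij).symm
  have := tendsto_nhds_unique hlim hzero
  simpa [g] using this

end FunctionalEquations

section Pairs

variable {n : ℕ} {p : ℝ} {f : Set (Euc n) → Euc n → ℝ}

lemma matAct_permMatrix_stdFace (σ : Equiv.Perm (Fin n)) (Z : Finset (Fin n)) :
    matAct (σ.permMatrix ℝ) (stdFace Z) = stdFace (Z.map σ.symm.toEmbedding) := by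
  ext y
  rw [mem_matAct_iff]
  simp only [Matrix.permMatrix_mulVec]
  constructor
  · rintro ⟨z, ⟨h0, h1, hZ⟩, e⟩
    refine ⟨fun i => ?_, ?_, fun i hi => ?_⟩
    · rw [← e]
      exact h0 _
    · rw [← e]
      change ∑ i, z (σ i) ≤ 1
      rw [Equiv.sum_comp σ z]
      exact h1
    · obtain ⟨k, hk, rfl⟩ := Finset.mem_map.1 hi
      rw [← e]
      simpa using hZ k hk
  · rintro ⟨h0, h1, hZ⟩
    refine ⟨WithLp.ofLp y ∘ σ.symm, ⟨fun i => h0 _, ?_, fun i hi => ?_⟩, ?_⟩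
    · change ∑ i, y (σ.symm i) ≤ 1
      rw [Equiv.sum_comp σ.symm (fun i => y i)]
      exact h1
    · exact hZ _ (Finset.mem_map_of_mem _ hi)
    · ext i
      simp

lemma IsCovariantFunctional.faceValue_perm (hf : IsCovariantFunctional p f) (hn : n ≠ 0)
    {σ : Equiv.Perm (Fin n)} (hσ : Equiv.Perm.sign σ = 1) (Z : Finset (Fin n)) {s : ℝ} (hs : 0 < s)
    (a : Fin n → ℝ) :
    faceValue f (Z.map σ.symm.toEmbedding) s a = faceValue f Z s (a ∘ σ.symm) := by
  have hdet : (σ.permMatrix ℝ).det = 1 := by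
    rw [Matrix.det_permutation, hσ]
    simp
  have := hf.eq_faceValue hn (hdet.trans_gt one_pos) hs Z a
  rwa [matAct_permMatrix_stdFace, hdet, mul_one, Matrix.transpose_permMatrix,
    Matrix.permMatrix_mulVec] at this

lemma IsCovariantFunctional.faceValue_perm_of_nonempty (hf : IsCovariantFunctional p f) (hn : 2 ≤ n)
    (σ : Equiv.Perm (Fin n)) {Z : Finset (Fin n)} (hZ : Z.Nonempty) {s : ℝ} (hs : 0 < s)
    (a : Fin n → ℝ) :
    faceValue f (Z.map σ.symm.toEmbedding) s a = faceValue f Z s (a ∘ σ.symm) := by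
  obtain ⟨m, hm⟩ := hZ
  have hsq : ((Equiv.Perm.sign σ : ℤ) : ℝ) * ((Equiv.Perm.sign σ : ℤ) : ℝ) = 1 := by
    exact_mod_cast Int.isUnit_mul_self (Equiv.Perm.sign σ).isUnit
  have hdet : (σ.permMatrix ℝ * (1 : Matrix (Fin n) (Fin n) ℝ).updateCol m
      (Pi.single m ((Equiv.Perm.sign σ : ℤ) : ℝ))).det = 1 := by
    rw [Matrix.det_mul, Matrix.det_permutation, det_updateCol_one, Pi.single_eq_same, hsq]
  have := hf.eq_faceValue (by omega) (hdet.trans_gt one_pos) hs Z a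
  rw [matAct_mul, matAct_updateCol_stdFace Z hm, matAct_permMatrix_stdFace, hdet, mul_one,
    Matrix.transpose_mul, ← Matrix.mulVec_mulVec, Matrix.transpose_permMatrix,
    Matrix.permMatrix_mulVec, updateCol_one_transpose_mulVec,
    hf.faceValue_update hn hm hs hs] at this
  exact this

lemma IsCovariantFunctional.faceValue_single_eq (hf : IsCovariantFunctional p f) (hn : 3 ≤ n)
    (i j : Fin n) (c : ℝ) {s : ℝ} (hs : 0 < s) :
    faceValue f ∅ s (Pi.single i c) = faceValue f ∅ s (Pi.single j c) := by
  by_cases hij : i = j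
  · rw [hij]
  obtain ⟨l, hl⟩ : ∃ l, l ∉ ({i, j} : Finset (Fin n)) := by
    by_contra! h
    have := Finset.card_le_card (fun x _ => h x : Finset.univ ⊆ ({i, j} : Finset (Fin n)))
    rw [Finset.card_univ, Fintype.card_fin] at this
    have := this.trans Finset.card_le_two
    omega
  simp only [Finset.mem_insert, Finset.mem_singleton, not_or] at hl
  set σ : Equiv.Perm (Fin n) := (Equiv.swap i j * Equiv.swap i l).symm with hσdef
  have hσ : Equiv.Perm.sign σ = 1 := by
    change Equiv.Perm.sign (Equiv.swap i j * Equiv.swap i l)⁻¹ = 1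
    rw [Equiv.Perm.sign_inv, map_mul, Equiv.Perm.sign_swap hij, Equiv.Perm.sign_swap (Ne.symm hl.1)]
    rfl
  have := hf.faceValue_perm (by omega) hσ ∅ hs (Pi.single i c)
  rw [Finset.map_empty] at this
  rw [this]
  congr 1
  ext k
  have hσj : σ.symm j = i := by
    change Equiv.swap i j (Equiv.swap i l j) = i
    rw [Equiv.swap_apply_of_ne_of_ne (Ne.symm hij) (Ne.symm hl.2), Equiv.swap_apply_right]
  by_cases hk : k = j
  · subst hk
    simp [hσj]
  · have : σ.symm k ≠ i := fun h => hk (σ.symm.injective (h.trans hσj.symm))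
    simp [hk, this]

lemma IsCovariantFunctional.faceValue_compl_singleton_eq (hf : IsCovariantFunctional p f) (hn : 2 ≤ n)
    {i j : Fin n} {a b : Fin n → ℝ} (hab : a i = b j) {s t : ℝ} (hs : 0 < s) (ht : 0 < t) :
    faceValue f {i}ᶜ s a = faceValue f {j}ᶜ t b := by
  have hne : ∀ k : Fin n, ({k}ᶜ : Finset (Fin n)).Nonempty := fun k => by
    have : Nontrivial (Fin n) := Fin.nontrivial_iff_two_le.2 hn
    obtain ⟨l, hl⟩ := exists_ne k
    exact ⟨l, by simpa using hl⟩
  have h := hf.faceValue_perm_of_nonempty hn (Equiv.swap i j) (hne j) hs a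
  have e : (({j}ᶜ : Finset (Fin n)).map (Equiv.swap i j).symm.toEmbedding) = {i}ᶜ := by
    ext k
    rw [Finset.mem_map_equiv]
    simp [Equiv.swap_apply_eq_iff]
  rw [e] at h
  rw [h]
  refine hf.faceValue_congr hn (hne j) hs ht fun k hk => ?_
  simp only [Finset.mem_compl, Finset.mem_singleton, not_not] at hk
  simp [hk, hab]

lemma nonempty_compl_pair (hn : 3 ≤ n) (i j : Fin n) : ({i, j}ᶜ : Finset (Fin n)).Nonempty := by
  rw [← Finset.card_pos, Finset.card_compl, Fintype.card_fin]
  have := Finset.card_le_two (a := i) (b := j)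
  omega

lemma IsCovariantFunctional.faceValue_compl_pair_eq (hf : IsCovariantFunctional p f) (hn : 3 ≤ n)
    {i j i' j' : Fin n} (hij : i ≠ j) (hij' : i' ≠ j') {a b : Fin n → ℝ} (hi : a i = b i')
    (hj : a j = b j') {s t : ℝ} (hs : 0 < s) (ht : 0 < t) :
    faceValue f {i, j}ᶜ s a = faceValue f {i', j'}ᶜ t b := by
  obtain ⟨σ, hσi, hσj⟩ : ∃ σ : Equiv.Perm (Fin n), σ i = i' ∧ σ j = j' := by
    refine ⟨Equiv.swap (Equiv.swap i i' j) j' * Equiv.swap i i', ?_, ?_⟩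
    · rw [Equiv.Perm.mul_apply, Equiv.swap_apply_left, Equiv.swap_apply_of_ne_of_ne _ hij']
      intro h
      exact hij ((Equiv.swap i i').injective ((Equiv.swap_apply_left i i').trans h))
    · rw [Equiv.Perm.mul_apply, Equiv.swap_apply_left]
  have h := hf.faceValue_perm_of_nonempty (by omega) σ (nonempty_compl_pair hn i' j') hs a
  have e : (({i', j'}ᶜ : Finset (Fin n)).map σ.symm.toEmbedding) = {i, j}ᶜ := by
    ext k
    rw [Finset.mem_map_equiv]
    simp [← hσi, ← hσj]
  rw [e] at h
  rw [h]
  refine hf.faceValue_congr (by omega) (nonempty_compl_pair hn i' j') hs ht fun k hk => ?_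
  simp only [Finset.mem_compl, Finset.mem_insert, Finset.mem_singleton, not_not] at hk
  rcases hk with rfl | rfl
  · rw [Function.comp_apply, ← hi, ← hσi, Equiv.symm_apply_apply]
  · rw [Function.comp_apply, ← hj, ← hσj, Equiv.symm_apply_apply]

/-- The vector with entries `x` at `i`, `y` at `j`, and `1` elsewhere. -/
def pairVec (i j : Fin n) (x y : ℝ) (k : Fin n) : ℝ :=
  if k = i then x else if k = j then y else 1

lemma IsCovariantFunctional.exists_pair_coeff (hf : IsCovariantFunctional p f) (hn : 3 ≤ n)
    (hp : 0 < p) (h1 : ∀ i : Fin n, ∀ s, 0 < s → ∀ a, faceValue f {i}ᶜ s a = 0) :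
    ∃ β : ℝ, ∀ i j : Fin n, i ≠ j → ∀ s, 0 < s → ∀ a : Fin n → ℝ, 0 ≤ a i → a i ≤ a j →
      faceValue f {i, j}ᶜ s a = β * (a j ^ p - a i ^ p) := by
  set i₀ : Fin n := ⟨0, by omega⟩
  set j₀ : Fin n := ⟨1, by omega⟩
  have h₀ : i₀ ≠ j₀ := by simp [i₀, j₀]
  have hz : ∀ i j : Fin n, i ≠ j → ∀ s, 0 < s → ∀ a : Fin n → ℝ, a i = 0 → 0 ≤ a j →
      faceValue f {i, j}ᶜ s a = faceValue f {i₀, j₀}ᶜ 1 (pairVec i₀ j₀ 0 1) * a j ^ p := by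
    intro i j hij s hs a hi hj
    rw [hf.faceValue_compl_pair_eq hn hij h₀ (b := a j • pairVec i₀ j₀ 0 1)
      (by simp [pairVec, hi]) (by simp [pairVec, h₀.symm]) hs one_pos,
      hf.faceValue_smul one_pos _ hj, mul_comm]
  refine ⟨faceValue f {i₀, j₀}ᶜ 1 (pairVec i₀ j₀ 0 1), fun i j hij s hs a hi hle => ?_⟩
  rcases hi.eq_or_lt with hi | hi
  · rw [hz i j hij s hs a hi.symm (hi.trans_le hle), ← hi, Real.zero_rpow hp.ne', sub_zero]
  rcases hle.eq_or_lt with hle | hle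
  · rw [hle, sub_self, mul_zero]
    rw [← hf.faceValue_insert (by omega) (nonempty_compl_pair hn i j) hij (by simp) hle one_pos hs]
    have : insert j ({i, j}ᶜ : Finset (Fin n)) = {i}ᶜ := by
      ext k
      by_cases hk : k = j <;> simp [hk, hij.symm]
    rw [this]
    exact h1 i 1 one_pos a
  · obtain ⟨r, hr0, hr1, hc⟩ := exists_ratio (x := Function.update a i 0 i) (y := Function.update a i 0 j)
      (c := a i) (by
        simp only [Function.update_self, Function.update_of_ne hij.symm]
        exact mul_pos (by linarith) (by linarith))
    have := hf.faceValue_split (Z := {i, j}ᶜ) hij (by simp) (by simp) hr0 hr1 hs _ hc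
    have e : insert j ({i, j}ᶜ : Finset (Fin n)) = {i}ᶜ := by
      ext k
      by_cases hk : k = j <;> simp [hk, hij.symm]
    rw [e, h1 i _ (mul_pos hs (sub_pos.2 hr1)), hz i j hij s hs _ (by simp) (by simp [hij.symm]; linarith),
      hz i j hij _ (mul_pos hs hr0) _ (by simp [hij]) (by simp [hi.le]), Function.update_idem,
      Function.update_eq_self, hf.faceValue_congr (by omega) (nonempty_compl_pair hn i j)
        (mul_pos hs (sub_pos.2 hr1)) hs (fun _ _ => rfl)] at this
    simp only [Function.update_self, Function.update_of_ne hij.symm] at this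
    linarith

/-- A midpoint inequality at three vectors with a repeated entry passes to the faces. -/
lemma IsCovariantFunctional.faceValue_midpoint (hf : IsCovariantFunctional p f) (hn : 2 ≤ n)
    (h0 : ∀ P, IsOriginPolytope P → ∀ x, 0 ≤ f P x)
    (hc : ∀ P, IsOriginPolytope P → ∀ x y,
      f P ((1 / 2 : ℝ) • (x + y)) ≤ (f P x + f P y) / 2)
    {a b c : Fin n → ℝ} (habc : c = (1 / 2 : ℝ) • (a + b)) {ia ja ib jb ic jc : Fin n}
    (hija : ia ≠ ja) (hijb : ib ≠ jb) (hijc : ic ≠ jc) (ha : a ia = a ja) (hb : b ib = b jb)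
    (hc' : c ic = c jc) :
    faceValue f {jc} 1 c ≤ (faceValue f {ja} 1 a + faceValue f {jb} 1 b) / 2 := by
  have hnonneg : ∀ a s, 0 < s → -0 ≤ faceValue f ∅ s a := fun a s _ => by
    rw [neg_zero]
    exact h0 _ ((isOriginPolytope_stdFace _).smul _) _
  obtain ⟨wa, hwa, ea⟩ := hf.faceValue_empty_of_eq hn hija ha (hnonneg a)
  obtain ⟨wb, hwb, eb⟩ := hf.faceValue_empty_of_eq hn hijb hb (hnonneg b)
  obtain ⟨wc, hwc, ec⟩ := hf.faceValue_empty_of_eq hn hijc hc' (hnonneg c)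
  refine le_of_forall_pos_le_add fun ε hε => ?_
  have hs : 0 < ε / (wa + wb + 1) := by positivity
  have hmid : ∀ s, faceValue f ∅ s c ≤ (faceValue f ∅ s a + faceValue f ∅ s b) / 2 := by
    intro s
    have := hc _ ((isOriginPolytope_stdFace ∅).smul (s ^ (1 / n : ℝ)))
      ((s ^ (1 / n : ℝ))⁻¹ • WithLp.toLp 2 a) ((s ^ (1 / n : ℝ))⁻¹ • WithLp.toLp 2 b)
    have e : (1 / 2 : ℝ) • ((s ^ (1 / n : ℝ))⁻¹ • WithLp.toLp 2 a + (s ^ (1 / n : ℝ))⁻¹ • WithLp.toLp 2 b)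
        = (s ^ (1 / n : ℝ))⁻¹ • WithLp.toLp 2 c := by
      rw [habc, ← smul_add, smul_comm]
      rfl
    rw [e] at this
    exact this
  have := hmid (ε / (wa + wb + 1))
  rw [ea _ hs, eb _ hs, ec _ hs] at this
  have h1 : ε / (wa + wb + 1) * (wa + wb) ≤ ε := by
    rw [div_mul_eq_mul_div, div_le_iff₀ (by positivity)]
    nlinarith
  have h2 : 0 ≤ ε / (wa + wb + 1) * wc := by positivity
  nlinarith

lemma IsCovariantFunctional.pair_eq_zero (hf : IsCovariantFunctional p f) (hn : 3 ≤ n) (hp : 1 < p)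
    (h0 : ∀ P, IsOriginPolytope P → ∀ x, 0 ≤ f P x)
    (hc : ∀ P, IsOriginPolytope P → ∀ x y,
      f P ((1 / 2 : ℝ) • (x + y)) ≤ (f P x + f P y) / 2)
    {F : Set (Euc n) → Euc n → ℝ} (hF : IsCovariantFunctional p F)
    (h1 : ∀ i : Fin n, ∀ s, 0 < s → ∀ a, faceValue F {i}ᶜ s a = 0) {A : ℝ}
    (hA : ∀ a : Fin n → ℝ, (∀ k, 0 ≤ a k) → (∀ k, a k ≤ 1) → ∀ Z : Finset (Fin n),
      (∃ k ∉ Z, a k = 1) → faceValue f Z 1 a = faceValue F Z 1 a + A)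
    {i j : Fin n} (hij : i ≠ j) {s : ℝ} (hs : 0 < s) {a : Fin n → ℝ} (hi : 0 ≤ a i) (hj : 0 ≤ a j) :
    faceValue F {i, j}ᶜ s a = 0 := by
  obtain ⟨β, hβ⟩ := hF.exists_pair_coeff hn (by linarith) h1
  suffices hβ0 : β = 0 by
    rcases le_total (a i) (a j) with h | h
    · rw [hβ i j hij s hs a hi h, hβ0, zero_mul]
    · rw [Finset.pair_comm, hβ j i hij.symm s hs a hj h, hβ0, zero_mul]
  obtain ⟨i, l, m, hil, him, hlm⟩ : ∃ i l m : Fin n, i ≠ l ∧ i ≠ m ∧ l ≠ m :=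
    ⟨⟨0, by omega⟩, ⟨1, by omega⟩, ⟨2, by omega⟩, by simp, by simp, by simp⟩
  have val : ∀ i l : Fin n, i ≠ l → i ≠ m → l ≠ m → ∀ x y, 0 ≤ x → x ≤ 1 → 0 ≤ y → y ≤ 1 →
      (x = y ∨ y = 1) →
      faceValue f {l} 1 (pairVec i l x y) = β * (1 - x ^ p) + A := by
    intro i l hil him hlm x y hx hx' hy hy' hxy
    have e1 : pairVec i l x y i = x := by simp [pairVec]
    have e2 : pairVec i l x y l = y := by simp [pairVec, hil.symm]
    have e3 : ∀ k, k ≠ i → k ≠ l → pairVec i l x y k = 1 := fun k hk hk' => by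
      simp [pairVec, hk, hk']
    have e4 := e3 m him.symm hlm.symm
    rw [hA _ _ _ {l} ⟨m, by simpa using hlm.symm, e4⟩,
      hF.faceValue_eq_of_subset (by omega) (Finset.singleton_nonempty l) (Z' := {i, m}ᶜ)
        (by simp [hil.symm, hlm]) _ one_pos one_pos, hβ i m him 1 one_pos _ (by rw [e1]; exact hx)
        (by rw [e1, e4]; exact hx'), e1, e4, Real.one_rpow]
    · intro k hk hkl
      simp only [Finset.mem_compl, Finset.mem_insert, Finset.mem_singleton, not_or] at hk hkl
      exact ⟨m, by simp, by rw [e4, e3 k hk.1 hkl]⟩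
    · intro k
      unfold pairVec
      split_ifs <;> linarith
    · intro k
      unfold pairVec
      split_ifs <;> linarith
  have hswap : ∀ x y, pairVec i l x y = pairVec l i y x := by
    intro x y
    ext k
    unfold pairVec
    by_cases hk : k = i
    · subst hk; simp [hil]
    · simp [hk]
  have hp0 : (0 : ℝ) ^ p = 0 := Real.zero_rpow (by linarith)
  have hhalf : (1 / 2 : ℝ) ^ p < 1 / 2 := by
    have := Real.rpow_lt_rpow_of_exponent_gt (x := 1 / 2) (by norm_num) (by norm_num) hp
    rwa [Real.rpow_one] at this
  have hhalf0 : 0 < (1 / 2 : ℝ) ^ p := by positivity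
  have v : ∀ x y, pairVec i l x y i = x ∧ pairVec i l x y l = y ∧ pairVec i l x y m = 1 := by
    intro x y
    simp [pairVec, hil.symm, him.symm, hlm.symm]
  have m1 := hf.faceValue_midpoint (by omega) h0 hc (a := pairVec i l 0 1) (b := pairVec i l 1 0)
    (c := pairVec i l (1 / 2) (1 / 2)) (ia := m) (ja := l) (ib := m) (jb := i) (ic := i) (jc := l)
    (by
      ext k
      simp only [pairVec, Pi.smul_apply, Pi.add_apply, smul_eq_mul]
      split_ifs <;> norm_num)
    hlm.symm him.symm hil (by simp [v]) (by simp [v]) (by simp [v])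
  have m2 := hf.faceValue_midpoint (by omega) h0 hc (a := pairVec i l 0 0) (b := pairVec i l 1 1)
    (c := pairVec i l (1 / 2) (1 / 2)) (ia := i) (ja := l) (ib := i) (jb := l) (ic := i) (jc := l)
    (by
      ext k
      simp only [pairVec, Pi.smul_apply, Pi.add_apply, smul_eq_mul]
      split_ifs <;> norm_num)
    hil hil hil (by simp [v]) (by simp [v]) (by simp [v])
  rw [hswap 1 0, val i l hil him hlm _ _ (by norm_num) (by norm_num) (by norm_num) (by norm_num) (.inl rfl),
    val i l hil him hlm _ _ le_rfl zero_le_one zero_le_one le_rfl (.inr rfl),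
    val l i hil.symm hlm him _ _ le_rfl zero_le_one zero_le_one le_rfl (.inr rfl), hp0] at m1
  rw [val i l hil him hlm _ _ (by norm_num) (by norm_num) (by norm_num) (by norm_num) (.inl rfl),
    val i l hil him hlm _ _ le_rfl zero_le_one le_rfl zero_le_one (.inl rfl),
    val i l hil him hlm _ _ zero_le_one le_rfl zero_le_one le_rfl (.inl rfl), hp0, Real.one_rpow] at m2
  nlinarith

end Pairs

section Support

variable {n : ℕ} {p : ℝ}

lemma bddAbove_inner_image {K : Set (Euc n)} (hK : IsCompact K) (x : Euc n) :
    BddAbove ((fun y => ⟪x, y⟫) '' K) :=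
  (hK.image (continuous_const.inner continuous_id)).bddAbove

lemma inner_le_supp {K : Set (Euc n)} (hK : IsCompact K) (x : Euc n) {y : Euc n} (hy : y ∈ K) :
    ⟪x, y⟫ ≤ supp K x :=
  le_csSup (bddAbove_inner_image hK x) ⟨y, hy, rfl⟩

lemma supp_le {K : Set (Euc n)} (hK : K.Nonempty) {x : Euc n} {c : ℝ} (h : ∀ y ∈ K, ⟪x, y⟫ ≤ c) :
    supp K x ≤ c :=
  csSup_le (hK.image _) (by rintro _ ⟨y, hy, rfl⟩; exact h y hy)

lemma exists_inner_eq_supp {K : Set (Euc n)} (hK : IsCompact K) (hne : K.Nonempty) (x : Euc n) :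
    ∃ y ∈ K, ⟪x, y⟫ = supp K x :=
  (hK.image (continuous_const.inner continuous_id)).sSup_mem (hne.image _)

lemma supp_nonneg {K : Set (Euc n)} (hK : IsCompact K) (h0 : 0 ∈ K) (x : Euc n) : 0 ≤ supp K x := by
  simpa using inner_le_supp hK x h0

lemma continuous_supp {K : Set (Euc n)} (hK : IsCompact K) : Continuous (supp K) :=
  hK.continuous_sSup (f := fun x y => ⟪x, y⟫) (continuous_fst.inner continuous_snd)

lemma supp_smul {K : Set (Euc n)} {t : ℝ} (ht : 0 ≤ t) (x : Euc n) : supp K (t • x) = t * supp K x := by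
  simp only [supp, ← smul_eq_mul, ← Real.sSup_smul_of_nonneg ht, ← Set.image_smul, Set.image_image,
    real_inner_smul_left]

lemma inner_matAct (M : Matrix (Fin n) (Fin n) ℝ) (x y : Euc n) :
    ⟪x, Matrix.toEuclideanLin M y⟫ = ⟪matVec Mᵀ x, y⟫ := by
  simp only [matVec, Matrix.toLpLin_apply, EuclideanSpace.inner_eq_star_dotProduct, star_trivial]
  rw [Matrix.mulVec_transpose, dotProduct_comm, Matrix.dotProduct_mulVec, dotProduct_comm]

lemma supp_matAct (M : Matrix (Fin n) (Fin n) ℝ) (K : Set (Euc n)) (x : Euc n) :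
    supp (matAct M K) x = supp K (matVec Mᵀ x) := by
  simp only [supp, matAct, Set.image_image, inner_matAct]

lemma supp_union {K L : Set (Euc n)} (hK : IsCompact K) (hL : IsCompact L) (hK0 : 0 ∈ K) (hL0 : 0 ∈ L)
    (x : Euc n) : supp (K ∪ L) x = max (supp K x) (supp L x) := by
  simp only [supp, Set.image_union]
  exact csSup_union (bddAbove_inner_image hK x) (Set.Nonempty.image _ ⟨0, hK0⟩)
    (bddAbove_inner_image hL x) (Set.Nonempty.image _ ⟨0, hL0⟩)

lemma supp_inter {K L : Set (Euc n)} (hK : IsCompact K) (hL : IsCompact L) (hK0 : 0 ∈ K) (hL0 : 0 ∈ L)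
    (hKL : Convex ℝ (K ∪ L)) (x : Euc n) : supp (K ∩ L) x = min (supp K x) (supp L x) := by
  refine le_antisymm (supp_le (K := K ∩ L) ⟨0, hK0, hL0⟩ fun y hy =>
    le_min (inner_le_supp hK x hy.1) (inner_le_supp hL x hy.2)) ?_
  obtain ⟨y, hy, ey⟩ := exists_inner_eq_supp hK ⟨0, hK0⟩ x
  obtain ⟨z, hz, ez⟩ := exists_inner_eq_supp hL ⟨0, hL0⟩ x
  obtain ⟨w, hw, hwK, hwL⟩ := isPreconnected_closed_iff.1 (convex_segment (𝕜 := ℝ) y z).isPreconnected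
    K L hK.isClosed hL.isClosed (hKL.segment_subset (Set.mem_union_left _ hy) (Set.mem_union_right _ hz))
    (Set.nonempty_of_mem ⟨left_mem_segment ℝ y z, hy⟩)
    (Set.nonempty_of_mem ⟨right_mem_segment ℝ y z, hz⟩)
  refine le_trans ?_ (inner_le_supp (hK.inter_right hL.isClosed) x ⟨hwK, hwL⟩)
  obtain ⟨a, b, ha, hb, hab, rfl⟩ := hw
  rw [inner_add_right, real_inner_smul_right, real_inner_smul_right, ey, ez]
  calc min (supp K x) (supp L x) = a * min (supp K x) (supp L x) + b * min (supp K x) (supp L x) := by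
        rw [← add_mul, hab, one_mul]
    _ ≤ _ := by
        gcongr
        · exact min_le_left _ _
        · exact min_le_right _ _

lemma eq_of_supp_eq {K L : Set (Euc n)} (hK : IsConvexBody0 K) (hL : IsConvexBody0 L)
    (h : ∀ x, supp K x = supp L x) : K = L := by
  have key : ∀ {K L : Set (Euc n)}, IsConvexBody0 K → IsConvexBody0 L → (∀ x, supp K x = supp L x) →
      K ⊆ L := by
    intro K L hK hL h y hy
    by_contra hyL
    obtain ⟨φ, u, h1, h2⟩ := geometric_hahn_banach_closed_point hL.2.1 hL.1.isClosed hyL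
    set x := (InnerProductSpace.toDual ℝ (Euc n)).symm φ
    have hx : ∀ z, ⟪x, z⟫ = φ z := fun z => InnerProductSpace.toDual_symm_apply
    have a := inner_le_supp hK.1 x hy
    have b := supp_le (x := x) (c := u) ⟨0, hL.2.2⟩ fun z hz => by
      rw [hx]
      exact (h1 z hz).le
    rw [hx] at a
    linarith [h x]
  exact (key hK hL h).antisymm (key hL hK fun x => (h x).symm)

lemma IsOriginPolytope.isCompact {P : Set (Euc n)} (hP : IsOriginPolytope P) : IsCompact P := by
  obtain ⟨⟨S, rfl⟩, -⟩ := hP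
  exact S.finite_toSet.isCompact_convexHull ℝ

lemma IsOriginPolytope.isConvexBody0 {P : Set (Euc n)} (hP : IsOriginPolytope P) : IsConvexBody0 P :=
  ⟨hP.isCompact, hP.convex, hP.2⟩

lemma IsConvexBody0.matAct {K : Set (Euc n)} (hK : IsConvexBody0 K) (M : Matrix (Fin n) (Fin n) ℝ) :
    IsConvexBody0 (matAct M K) :=
  ⟨hK.1.image (LinearMap.continuous_of_finiteDimensional _), hK.2.1.linear_image _,
    ⟨0, hK.2.2, map_zero _⟩⟩

lemma hyperplaneAdditive_of_valuation {F : Set (Euc n) → ℝ}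
    (hF : ∀ K L : Set (Euc n), IsPolytope0 K → IsPolytope0 L → IsPolytope0 (K ∪ L) →
      IsPolytope0 (K ∩ L) → F (K ∪ L) + F (K ∩ L) = F K + F L) : HyperplaneAdditive F := by
  intro P hP k
  have hu : (P ∩ {y | k y ≤ 0}) ∪ (P ∩ {y | 0 ≤ k y}) = P := by
    rw [← Set.inter_union_distrib_left, Set.inter_eq_left]
    exact fun y _ => le_total (k y) 0
  have hi : (P ∩ {y | k y ≤ 0}) ∩ (P ∩ {y | 0 ≤ k y}) = P ∩ {y | k y = 0} := by
    rw [← Set.inter_inter_distrib_left]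
    congr 1
    ext y
    exact (le_antisymm_iff (a := k y) (b := 0)).symm
  have := hF _ _ (hP.inter_halfspace k) (hP.inter_halfspace_ge k) (by rw [hu]; exact hP)
    (by rw [hi]; exact hP.inter_hyperplane k)
  rwa [hu, hi] at this

lemma valuationLp_id (p : ℝ) : ValuationLp (n := n) p id := by
  intro K L hK hL hU _ x
  have hK' : IsOriginPolytope K := hK
  have hL' : IsOriginPolytope L := hL
  have hU' : IsOriginPolytope (K ∪ L) := hU
  simp only [id]
  rw [supp_union hK'.isCompact hL'.isCompact hK.2 hL.2,
    supp_inter hK'.isCompact hL'.isCompact hK.2 hL.2 hU'.convex]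
  rcases le_total (supp K x) (supp L x) with h | h
  · rw [max_eq_right h, min_eq_left h, add_comm]
  · rw [max_eq_left h, min_eq_right h]

lemma isCovariantFunctional_supp (hp : 0 < p) {Z : Set (Euc n) → Set (Euc n)}
    (hbody : ∀ P : Set (Euc n), IsPolytope0 P → IsConvexBody0 (Z P)) (hZ : ValuationLp p Z)
    (hcov : SLCovariant Z) : IsCovariantFunctional p fun P x => supp (Z P) x ^ p where
  add x := hyperplaneAdditive_of_valuation fun K L hK hL hU hI => hZ K L hK hL hU hI x
  cov φ P hP x := by
    rw [hcov φ P hP, supp_matAct]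
  cont P hP := (continuous_supp (hbody P hP).1).rpow_const fun _ => .inr hp.le
  homog P hP t ht x := by
    rw [supp_smul ht, Real.mul_rpow ht (supp_nonneg (hbody P hP).1 (hbody P hP).2.2 x)]

variable {f g : Set (Euc n) → Euc n → ℝ}

lemma IsCovariantFunctional.linear_combination (hf : IsCovariantFunctional p f)
    (hg : IsCovariantFunctional p g) (c : ℝ) :
    IsCovariantFunctional p fun P x => f P x + c * g P x where
  add x P hP k := by
    have h1 := hf.add x P hP k
    have h2 := hg.add x P hP k
    simp only at h1 h2 ⊢
    linear_combination h1 + c * h2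
  cov φ P hP x := by rw [hf.cov φ P hP, hg.cov φ P hP]
  cont P hP := (hf.cont P hP).add (continuous_const.mul (hg.cont P hP))
  homog P hP t ht x := by
    rw [hf.homog P hP t ht, hg.homog P hP t ht]
    ring

lemma IsCovariantFunctional.reflect (hf : IsCovariantFunctional p f) :
    IsCovariantFunctional p fun P x => f P (-x) where
  add x := hf.add (-x)
  cov φ P hP x := by
    rw [hf.cov φ P hP]
    congr 1
    exact map_neg _ _
  cont P hP := (hf.cont P hP).comp continuous_neg
  homog P hP t ht x := by rw [← smul_neg, hf.homog P hP t ht]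

lemma faceValue_reflect (Z : Finset (Fin n)) (s : ℝ) (a : Fin n → ℝ) :
    faceValue (fun P x => f P (-x)) Z s a = faceValue f Z s (-a) := by
  simp only [faceValue, rescale]
  rw [← smul_neg]
  rfl

lemma faceValue_supp {s : ℝ} (hs : 0 < s) (Z : Finset (Fin n)) (a : Fin n → ℝ) :
    faceValue (fun P x => supp P x ^ p) Z s a = supp (stdFace Z) (WithLp.toLp 2 a) ^ p := by
  have ht : s ^ (1 / n : ℝ) ≠ 0 := (Real.rpow_pos_of_pos hs _).ne'
  simp only [faceValue, rescale, supp]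
  rw [← Set.image_smul, Set.image_image]
  congr 3
  ext y
  rw [real_inner_smul_left, real_inner_smul_right, inv_mul_cancel_left₀ ht]

lemma inner_toLp_stdFace (a : Fin n → ℝ) (y : Euc n) : ⟪WithLp.toLp 2 a, y⟫ = ∑ i, a i * y i := by
  simp [PiLp.inner_apply, mul_comm]

lemma supp_stdFace_le {Z : Finset (Fin n)} {a : Fin n → ℝ} {c : ℝ} (hc : 0 ≤ c) (h : ∀ i ∉ Z, a i ≤ c) :
    supp (stdFace Z) (WithLp.toLp 2 a) ≤ c := by
  refine supp_le ⟨0, (isOriginPolytope_stdFace Z).2⟩ fun y ⟨h0, h1, hZ⟩ => ?_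
  rw [inner_toLp_stdFace]
  calc ∑ i, a i * y i ≤ ∑ i, c * y i := Finset.sum_le_sum fun i _ => by
        by_cases hi : i ∈ Z
        · simp [hZ i hi]
        · exact mul_le_mul_of_nonneg_right (h i hi) (h0 i)
    _ = c * ∑ i, y i := (Finset.mul_sum _ _ _).symm
    _ ≤ c := by nlinarith

lemma le_supp_stdFace {Z : Finset (Fin n)} (a : Fin n → ℝ) {i : Fin n} (hi : i ∉ Z) :
    a i ≤ supp (stdFace Z) (WithLp.toLp 2 a) := by
  have hm : EuclideanSpace.single i (1 : ℝ) ∈ stdFace Z := by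
    rw [stdFace_eq_convexHull]
    exact subset_convexHull ℝ _ (.inr ⟨i, hi, rfl⟩)
  have := inner_le_supp (isOriginPolytope_stdFace Z).isCompact (WithLp.toLp 2 a) hm
  rwa [inner_toLp_stdFace, Finset.sum_eq_single i (by simp +contextual) (by simp),
    PiLp.single_apply, if_pos rfl, mul_one] at this

lemma supp_stdFace_nonneg (Z : Finset (Fin n)) (x : Euc n) : 0 ≤ supp (stdFace Z) x :=
  supp_nonneg (isOriginPolytope_stdFace Z).isCompact (isOriginPolytope_stdFace Z).2 x

lemma supp_stdFace_eq {Z : Finset (Fin n)} {a : Fin n → ℝ} {i : Fin n} (hi : i ∉ Z) (h0 : 0 ≤ a i)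
    (h : ∀ k ∉ Z, a k ≤ a i) : supp (stdFace Z) (WithLp.toLp 2 a) = a i :=
  (supp_stdFace_le h0 h).antisymm (le_supp_stdFace a hi)

lemma supp_stdFace_eq_zero {Z : Finset (Fin n)} {a : Fin n → ℝ} (h : ∀ k ∉ Z, a k ≤ 0) :
    supp (stdFace Z) (WithLp.toLp 2 a) = 0 :=
  (supp_stdFace_le le_rfl h).antisymm (supp_stdFace_nonneg Z _)

end Support

section SupportDefect

variable {n : ℕ} {p : ℝ} {f : Set (Euc n) → Euc n → ℝ}

/-- The functional `f` minus multiples of the functionals of `P` and `-P`. -/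
def supportDefect (p : ℝ) (f : Set (Euc n) → Euc n → ℝ) (A A' : ℝ) (P : Set (Euc n)) (x : Euc n) : ℝ :=
  f P x + -A * supp P x ^ p + -A' * supp P (-x) ^ p

lemma isCovariantFunctional_supp_self (hp : 0 < p) :
    IsCovariantFunctional p fun (P : Set (Euc n)) x => supp P x ^ p :=
  isCovariantFunctional_supp hp (Z := id) (fun _ hP => IsOriginPolytope.isConvexBody0 hP)
    (valuationLp_id p) fun _ _ _ => rfl

lemma isCovariantFunctional_supportDefect (hf : IsCovariantFunctional p f) (hp : 0 < p) (A A' : ℝ) :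
    IsCovariantFunctional p (supportDefect p f A A') :=
  (hf.linear_combination (isCovariantFunctional_supp_self hp) (-A)).linear_combination
    (isCovariantFunctional_supp_self hp).reflect (-A')

lemma supportDefect_reflect (A A' : ℝ) :
    supportDefect p (fun P x => f P (-x)) A' A = fun P x => supportDefect p f A A' P (-x) := by
  ext P x
  simp only [supportDefect, neg_neg]
  ring

lemma faceValue_supportDefect (A A' : ℝ) (Z : Finset (Fin n)) {s : ℝ} (hs : 0 < s) (a : Fin n → ℝ) :
    faceValue (supportDefect p f A A') Z s a = faceValue f Z s a
      + -A * supp (stdFace Z) (WithLp.toLp 2 a) ^ p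
      + -A' * supp (stdFace Z) (WithLp.toLp 2 (-a)) ^ p := by
  rw [← faceValue_supp hs, ← faceValue_supp hs, ← faceValue_reflect]
  rfl

lemma IsCovariantFunctional.supportDefect_pair_eq_zero_of_nonneg (hf : IsCovariantFunctional p f)
    (hn : 3 ≤ n) (hp : 1 < p) (h0 : ∀ P, IsOriginPolytope P → ∀ x, 0 ≤ f P x)
    (hc : ∀ P, IsOriginPolytope P → ∀ x y,
      f P ((1 / 2 : ℝ) • (x + y)) ≤ (f P x + f P y) / 2) {A A' : ℝ}
    (h1 : ∀ i : Fin n, ∀ s, 0 < s → ∀ a, faceValue (supportDefect p f A A') {i}ᶜ s a = 0)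
    {i j : Fin n} (hij : i ≠ j) {s : ℝ} (hs : 0 < s) {a : Fin n → ℝ} (hi : 0 ≤ a i) (hj : 0 ≤ a j) :
    faceValue (supportDefect p f A A') {i, j}ᶜ s a = 0 := by
  refine hf.pair_eq_zero hn hp h0 hc (isCovariantFunctional_supportDefect hf (by linarith) A A') h1 (A := A) ?_ hij hs hi hj
  rintro a ha0 ha1 Z ⟨k, hk, hk1⟩
  rw [faceValue_supportDefect _ _ _ one_pos, supp_stdFace_eq hk (ha0 k) (fun l _ => hk1 ▸ ha1 l),
    supp_stdFace_eq_zero (a := -a) (fun l _ => by simpa using ha0 l), hk1, Real.one_rpow,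
    Real.zero_rpow (by linarith)]
  ring

lemma IsCovariantFunctional.supportDefect_eq_zero (hf : IsCovariantFunctional p f)
    (hn : 3 ≤ n) (hp : 1 < p) (h0 : ∀ P, IsOriginPolytope P → ∀ x, 0 ≤ f P x)
    (hc : ∀ P, IsOriginPolytope P → ∀ x y,
      f P ((1 / 2 : ℝ) • (x + y)) ≤ (f P x + f P y) / 2) :
    ∃ A A' : ℝ, 0 ≤ A ∧ 0 ≤ A' ∧ ∀ Z : Finset (Fin n), Z.Nonempty → ∀ s, 0 < s → ∀ a,
      faceValue (supportDefect p f A A') Z s a = 0 := by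
  have hp0 : 0 < p := by linarith
  set i₀ : Fin n := ⟨0, by omega⟩
  have hfn : ∀ Z s a, 0 ≤ faceValue f Z s a := fun Z s a =>
    h0 _ ((isOriginPolytope_stdFace Z).smul _) _
  refine ⟨faceValue f {i₀}ᶜ 1 (fun _ => 1), faceValue f {i₀}ᶜ 1 (fun _ => -1), hfn _ _ _, hfn _ _ _, ?_⟩
  set A := faceValue f {i₀}ᶜ 1 (fun _ => 1) with hA
  set A' := faceValue f {i₀}ᶜ 1 (fun _ => -1) with hA'
  set F := supportDefect p f A A' with hFdef
  have hF : IsCovariantFunctional p F := isCovariantFunctional_supportDefect hf hp0 A A'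
  have h1 : ∀ i : Fin n, ∀ s, 0 < s → ∀ a, faceValue F {i}ᶜ s a = 0 := by
    intro i s hs a
    rw [hFdef, faceValue_supportDefect _ _ _ hs]
    rcases le_total 0 (a i) with h | h
    · rw [hf.faceValue_compl_singleton_eq (by omega) (j := i₀) (b := a i • fun _ => 1) (by simp) hs
        one_pos, hf.faceValue_smul one_pos _ h, supp_stdFace_eq (i := i) (by simp) h (by simp),
        supp_stdFace_eq_zero (by simpa using h), Real.zero_rpow hp0.ne', hA]
      ring
    · rw [hf.faceValue_compl_singleton_eq (by omega) (j := i₀) (b := (-a i) • fun _ => -1) (by simp) hs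
        one_pos, hf.faceValue_smul one_pos _ (neg_nonneg.2 h), supp_stdFace_eq_zero (by simpa using h),
        supp_stdFace_eq (a := -a) (i := i) (by simp) (by simpa using h) (by simp),
        Real.zero_rpow hp0.ne', hA', Pi.neg_apply]
      ring
  have hpos : ∀ i j : Fin n, i ≠ j → ∀ s, 0 < s → ∀ a : Fin n → ℝ, 0 ≤ a i → 0 ≤ a j →
      faceValue F {i, j}ᶜ s a = 0 := fun i j hij s hs a hi hj =>
    hf.supportDefect_pair_eq_zero_of_nonneg hn hp h0 hc h1 hij hs hi hj
  have hneg : ∀ i j : Fin n, i ≠ j → ∀ s, 0 < s → ∀ a : Fin n → ℝ, a i ≤ 0 → a j ≤ 0 →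
      faceValue F {i, j}ᶜ s a = 0 := by
    intro i j hij s hs a hi hj
    have e : ∀ Z a, faceValue (supportDefect p (fun P x => f P (-x)) A' A) Z s a =
        faceValue F Z s (-a) := fun Z a => by rw [supportDefect_reflect, faceValue_reflect]
    have := hf.reflect.supportDefect_pair_eq_zero_of_nonneg hn hp (A := A') (A' := A)
      (fun P hP x => h0 P hP _) (fun P hP x y => by
        rw [← smul_neg, neg_add]
        exact hc P hP _ _)
      (fun i s hs a => by rw [supportDefect_reflect, faceValue_reflect, h1 i s hs]) hij hs
      (a := -a) (by simpa using hi) (by simpa using hj)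
    rwa [e, neg_neg] at this
  have hmix : ∀ i j : Fin n, i ≠ j → ∀ s, 0 < s → ∀ a : Fin n → ℝ, a i < 0 → 0 < a j →
      faceValue F {i, j}ᶜ s a = 0 := by
    intro i j hij s hs a hi hj
    obtain ⟨r, hr0, hr1, hr⟩ := exists_ratio (x := a i) (y := a j) (c := 0) (by nlinarith)
    have := hF.faceValue_split (Z := {i, j}ᶜ) hij (by simp) (by simp) hr0 hr1 hs a hr
    have e : insert j ({i, j}ᶜ : Finset (Fin n)) = {i}ᶜ := by
      ext k
      by_cases hk : k = j <;> simp [hk, hij.symm]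
    rw [e, h1 i _ (mul_pos hs (sub_pos.2 hr1)), hneg i j hij _ (mul_pos hs hr0) _ (by simp [hij, hi.le])
      (by simp), hpos i j hij _ (mul_pos hs (sub_pos.2 hr1)) _ (by simp) (by simp [hij.symm, hj.le])] at this
    linarith
  have hpair : ∀ i j : Fin n, i ≠ j → ∀ s, 0 < s → ∀ a : Fin n → ℝ, faceValue F {i, j}ᶜ s a = 0 := by
    intro i j hij s hs a
    rcases le_or_gt 0 (a i) with h | h <;> rcases le_or_gt 0 (a j) with h' | h'
    · exact hpos i j hij s hs a h h'
    · rcases h.eq_or_lt with h | h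
      · exact hneg i j hij s hs a h.ge h'.le
      · rw [Finset.pair_comm]
        exact hmix j i hij.symm s hs a h' h
    · rcases h'.eq_or_lt with h' | h'
      · exact hneg i j hij s hs a h.le h'.ge
      · exact hmix i j hij s hs a h h'
    · exact hneg i j hij s hs a h.le h'.le
  intro Z hZ s hs a
  refine hF.faceValue_eq_zero_of_pairs (by omega) (fun Z hZ hcard s hs a => ?_) hZ hs a
  rw [← compl_compl Z]
  obtain h | h | h : Zᶜ.card = 0 ∨ Zᶜ.card = 1 ∨ Zᶜ.card = 2 := by omega
  · rw [Finset.card_eq_zero.1 h, Finset.compl_empty]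
    exact IsCovariantFunctional.faceValue_univ hp0 hF (by omega) hs a
  · obtain ⟨i, hi⟩ := Finset.card_eq_one.1 h
    rw [hi]
    exact h1 i s hs a
  · obtain ⟨i, j, hij, hi⟩ := Finset.card_eq_two.1 h
    rw [hi]
    exact hpair i j hij s hs a

end SupportDefect

section Moment

variable {n : ℕ} {p : ℝ} {f : Set (Euc n) → Euc n → ℝ}

/-- The `p`-th power of the support function of the asymmetric moment body. -/
def moment (p : ℝ) (P : Set (Euc n)) (x : Euc n) : ℝ :=
  ∫ y in P, max ⟪x, y⟫ 0 ^ p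

lemma continuous_moment_integrand (hp : 0 < p) (x : Euc n) :
    Continuous fun y : Euc n => max ⟪x, y⟫ 0 ^ p :=
  ((continuous_const.inner continuous_id).max continuous_const).rpow_const fun _ => .inr hp.le

lemma integrableOn_moment_integrand (hp : 0 < p) {K : Set (Euc n)} (hK : IsCompact K) (x : Euc n) :
    IntegrableOn (fun y => max ⟪x, y⟫ 0 ^ p) K :=
  (continuous_moment_integrand hp x).continuousOn.integrableOn_compact hK

lemma moment_nonneg (P : Set (Euc n)) (x : Euc n) : 0 ≤ moment p P x :=
  integral_nonneg fun _ => Real.rpow_nonneg (le_max_right _ _) _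

lemma moment_union_add_inter (hp : 0 < p) {K L : Set (Euc n)} (hK : IsCompact K) (hL : IsCompact L)
    (x : Euc n) : moment p (K ∪ L) x + moment p (K ∩ L) x = moment p K x + moment p L x := by
  simp only [moment]
  rw [← integral_add_measure (integrableOn_moment_integrand hp (hK.union hL) x)
      (integrableOn_moment_integrand hp (hK.inter_right hL.isClosed) x),
    Measure.restrict_union_add_inter _ hL.measurableSet,
    integral_add_measure (integrableOn_moment_integrand hp hK x)
      (integrableOn_moment_integrand hp hL x)]

lemma moment_smul {t : ℝ} (ht : 0 ≤ t) (P : Set (Euc n)) (x : Euc n) :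
    moment p P (t • x) = t ^ p * moment p P x := by
  simp only [moment]
  rw [← integral_const_mul]
  congr 1
  ext y
  rw [real_inner_smul_left, ← Real.mul_rpow ht (le_max_right _ _), mul_max_of_nonneg _ _ ht, mul_zero]

lemma moment_matAct {M : Matrix (Fin n) (Fin n) ℝ} (hM : M.det ≠ 0) {P : Set (Euc n)}
    (hP : IsCompact P) (x : Euc n) :
    moment p (matAct M P) x = |M.det| * moment p P (matVec Mᵀ x) := by
  have hdet : LinearMap.det (Matrix.toEuclideanLin M) = M.det := LinearMap.det_toLpLin _ _
  have hinj : Function.Injective (Matrix.toEuclideanLin M) :=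
    (LinearEquiv.ofIsUnitDet (f := Matrix.toEuclideanLin M) (v := EuclideanSpace.basisFun (Fin n) ℝ |>.toBasis)
      (v' := EuclideanSpace.basisFun (Fin n) ℝ |>.toBasis) (by
        rw [LinearMap.det_toMatrix, hdet]
        exact hM.isUnit)).injective
  simp only [moment, matAct]
  rw [← integral_const_mul]
  have := integral_image_eq_integral_abs_det_fderiv_smul volume hP.measurableSet
    (f := Matrix.toEuclideanLin M) (f' := fun _ => (Matrix.toEuclideanLin M).toContinuousLinearMap)
    (fun y _ => (Matrix.toEuclideanLin M).toContinuousLinearMap.hasFDerivWithinAt) hinj.injOn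
    (fun y => max ⟪x, y⟫ 0 ^ p)
  rw [this]
  congr 1
  ext y
  rw [inner_matAct, ContinuousLinearMap.det, LinearMap.coe_toContinuousLinearMap, hdet, smul_eq_mul]

lemma isCovariantFunctional_moment (hp : 0 < p) :
    IsCovariantFunctional p (moment (n := n) p) where
  add x := hyperplaneAdditive_of_valuation fun _ _ hK hL _ _ =>
    moment_union_add_inter hp (IsOriginPolytope.isCompact hK) (IsOriginPolytope.isCompact hL) x
  cov φ P hP x := by
    rw [moment_matAct (by rw [φ.2]; exact one_ne_zero) hP.isCompact, φ.2, abs_one, one_mul]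
  cont P hP := by
    refine continuous_parametric_integral_of_continuous (f := fun x y : Euc n => max ⟪x, y⟫ 0 ^ p) ?_
      hP.isCompact
    exact ((continuous_fst.inner continuous_snd).max continuous_const).rpow_const fun _ => .inr hp.le
  homog P _ t ht x := moment_smul ht P x

lemma faceValue_moment (hn : n ≠ 0) (Z : Finset (Fin n)) {s : ℝ} (hs : 0 < s) (a : Fin n → ℝ) :
    faceValue (moment p) Z s a = s * moment p (stdFace Z) (WithLp.toLp 2 a) := by
  have ht : 0 < s ^ (1 / n : ℝ) := Real.rpow_pos_of_pos hs _
  have hdet : ((s ^ (1 / n : ℝ)) • (1 : Matrix (Fin n) (Fin n) ℝ)).det = s := by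
    rw [Matrix.det_smul, Fintype.card_fin, Matrix.det_one, mul_one, one_div,
      Real.rpow_inv_natCast_pow hs.le hn]
  have hid : matAct (1 : Matrix (Fin n) (Fin n) ℝ) (stdFace Z) = stdFace Z := by
    ext y
    simp [mem_matAct_iff]
  have := moment_matAct (p := p) (hdet.trans_ne hs.ne') (isOriginPolytope_stdFace Z).isCompact
    ((s ^ (1 / n : ℝ))⁻¹ • WithLp.toLp 2 a)
  rw [matAct_smul, hid, hdet, abs_of_pos hs] at this
  rw [faceValue, rescale, this]
  congr 2
  ext i
  rw [one_div] at ht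
  simp [matVec, ht.ne']

lemma volume_stdFace_of_nonempty {Z : Finset (Fin n)} (hZ : Z.Nonempty) :
    volume (stdFace Z) = 0 := by
  obtain ⟨i, hi⟩ := hZ
  let H : Submodule ℝ (Euc n) := LinearMap.ker (EuclideanSpace.proj (𝕜 := ℝ) i).toLinearMap
  refine measure_mono_null (t := H) (fun y hy => ?_) (Measure.addHaar_submodule volume H fun h => ?_)
  · exact hy.2.2 i hi
  · have : EuclideanSpace.single i (1 : ℝ) ∈ H := by
      rw [h]
      trivial
    have : (EuclideanSpace.single i (1 : ℝ)) i = 0 := this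
    simp at this

lemma faceValue_moment_of_nonempty (hn : n ≠ 0) {Z : Finset (Fin n)} (hZ : Z.Nonempty) {s : ℝ}
    (hs : 0 < s) (a : Fin n → ℝ) : faceValue (moment p) Z s a = 0 := by
  rw [faceValue_moment hn Z hs, moment, setIntegral_measure_zero _ (volume_stdFace_of_nonempty hZ),
    mul_zero]

lemma moment_stdFace_single_pos (hp : 0 < p) (i : Fin n) :
    0 < moment p (stdFace ∅) (WithLp.toLp 2 (Pi.single i 1)) := by
  rw [moment, setIntegral_pos_iff_support_of_nonneg_ae
    (ae_of_all _ fun _ => Real.rpow_nonneg (le_max_right _ _) _)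
    (integrableOn_moment_integrand hp (isOriginPolytope_stdFace ∅).isCompact _)]
  let U : Set (Euc n) := {y | (∀ k, 0 < y k) ∧ ∑ k, y k < 1}
  have hU : IsOpen U := by
    have h1 : IsOpen {y : Euc n | ∀ k, 0 < y k} := by
      simp only [Set.ofPred_forall]
      exact isOpen_iInter_of_finite fun k => isOpen_lt continuous_const (by fun_prop)
    exact h1.inter (isOpen_lt (f := fun y : Euc n => ∑ k, y k) (by fun_prop) continuous_const)
  have hne : U.Nonempty := by
    refine ⟨WithLp.toLp 2 fun _ => 1 / (n + 1 : ℝ), fun k => by simp only; positivity, ?_⟩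
    simp only [Finset.sum_const, Finset.card_univ, Fintype.card_fin, nsmul_eq_mul]
    rw [mul_one_div, div_lt_one (by positivity)]
    linarith
  refine (hU.measure_pos volume hne).trans_le (measure_mono fun y hy => ⟨?_, ?_⟩)
  · rw [Function.mem_support, inner_toLp_stdFace]
    simp only [Pi.single_apply, ite_mul, one_mul, zero_mul, Finset.sum_ite_eq', Finset.mem_univ, if_true]
    exact (Real.rpow_pos_of_pos (lt_max_of_lt_left (hy.1 i)) _).ne'
  · exact ⟨fun k => (hy.1 k).le, hy.2.le, by simp⟩

lemma moment_stdFace_single_neg (hp : 0 < p) (i : Fin n) :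
    moment p (stdFace ∅) (WithLp.toLp 2 (Pi.single i (-1))) = 0 := by
  refine setIntegral_eq_zero_of_forall_eq_zero fun y hy => ?_
  rw [inner_toLp_stdFace]
  simp only [Pi.single_apply, ite_mul, neg_mul, one_mul, zero_mul, Finset.sum_ite_eq', Finset.mem_univ,
    if_true]
  rw [max_eq_right (neg_nonpos.2 (hy.1 i)), Real.zero_rpow hp.ne']

end Moment

section Classification

variable {n : ℕ} {p : ℝ} {f : Set (Euc n) → Euc n → ℝ}

lemma exists_basis_extending {m : ℕ} {v : Fin m → Euc n} (hv : LinearIndependent ℝ v) :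
    ∃ (b : Module.Basis (Fin n) ℝ (Euc n)) (T : Finset (Fin n)), b '' T = Set.range v := by
  classical
  let b' := Module.Basis.extend hv.linearIndepOn_id
  have : Fintype (hv.linearIndepOn_id.extend (Set.subset_univ _)) :=
    FiniteDimensional.fintypeBasisIndex b'
  have e := Fintype.equivFinOfCardEq
    ((Module.finrank_eq_card_basis b').symm.trans finrank_euclideanSpace_fin)
  refine ⟨b'.reindex e, Finset.univ.filter fun i => b'.reindex e i ∈ Set.range v, ?_⟩
  ext y
  constructor
  · rintro ⟨i, hi, rfl⟩
    simpa using hi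
  · rintro hy
    refine ⟨e ⟨y, hv.linearIndepOn_id.subset_extend _ hy⟩, ?_, ?_⟩
    · simpa [b'] using hy
    · simp [b']

lemma exists_matAct_stdFace (hn : 2 ≤ n) {m : ℕ} {v : Fin m → Euc n} (hv : LinearIndependent ℝ v) :
    ∃ (M : Matrix (Fin n) (Fin n) ℝ) (Z : Finset (Fin n)), 0 < M.det ∧
      convexHull ℝ (insert 0 (Set.range v)) = matAct M (stdFace Z) := by
  classical
  obtain ⟨b, T, hT⟩ := exists_basis_extending hv
  let A := (EuclideanSpace.basisFun (Fin n) ℝ).toBasis.equiv b (Equiv.refl _)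
  let M : Matrix (Fin n) (Fin n) ℝ := Matrix.toEuclideanLin.symm A.toLinearMap
  have hM : Matrix.toEuclideanLin M = A.toLinearMap := Matrix.toEuclideanLin.apply_symm_apply _
  have hdet : M.det ≠ 0 := by
    rw [← LinearMap.det_toLpLin 2 M]
    change LinearMap.det (Matrix.toEuclideanLin M) ≠ 0
    rw [hM]
    exact (LinearEquiv.isUnit_det' A).ne_zero
  have hA : ∀ i, A (EuclideanSpace.single i 1) = b i := fun i => by
    have := Module.Basis.equiv_apply (EuclideanSpace.basisFun (Fin n) ℝ).toBasis i b (Equiv.refl _)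
    simpa using this
  have himage : convexHull ℝ (insert 0 (Set.range v)) = matAct M (stdFace Tᶜ) := by
    rw [matAct, hM, stdFace_eq_convexHull, LinearMap.image_convexHull, Set.image_insert_eq, map_zero,
      Set.image_image, ← hT]
    congr 2
    ext y
    simp [hA]
  rcases hdet.lt_or_gt with h | h
  · let σ : Equiv.Perm (Fin n) := Equiv.swap ⟨0, by omega⟩ ⟨1, by omega⟩
    refine ⟨M * σ.permMatrix ℝ, Tᶜ.map σ.toEmbedding, ?_, ?_⟩
    · rw [Matrix.det_mul, Matrix.det_permutation, Equiv.Perm.sign_swap (by simp)]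
      simpa using h
    · rw [matAct_mul, matAct_permMatrix_stdFace, himage, Finset.map_map]
      congr 2
      ext k
      simp [σ]
  · exact ⟨M, Tᶜ, h, himage⟩

lemma IsCovariantFunctional.eq_zero_of_faceValue (hf : IsCovariantFunctional p f) (hn : 2 ≤ n)
    (h : ∀ Z : Finset (Fin n), ∀ s, 0 < s → ∀ a, faceValue f Z s a = 0) {P : Set (Euc n)}
    (hP : IsOriginPolytope P) (x : Euc n) : f P x = 0 := by
  refine (hf.add x).eq_zero (fun m v hv => ?_) hP
  obtain ⟨M, Z, hM, e⟩ := exists_matAct_stdFace hn hv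
  rw [e, hf.matAct_eq (by omega) hM (isOriginPolytope_stdFace Z)]
  exact h Z _ hM (matVec Mᵀ x).ofLp

/-- The `p`-th power of the support function of an `L_p` combination of moment bodies, `P` and `-P`. -/
def lpCombination (p C C' A A' : ℝ) (P : Set (Euc n)) (x : Euc n) : ℝ :=
  C * moment p P x + C' * moment p P (-x) + A * supp P x ^ p + A' * supp P (-x) ^ p

lemma IsCovariantFunctional.eq_lpCombination (hf : IsCovariantFunctional p f) (hn : 3 ≤ n)
    (hp : 1 < p) (h0 : ∀ P, IsOriginPolytope P → ∀ x, 0 ≤ f P x)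
    (hc : ∀ P, IsOriginPolytope P → ∀ x y,
      f P ((1 / 2 : ℝ) • (x + y)) ≤ (f P x + f P y) / 2) :
    ∃ C C' A A' : ℝ, 0 ≤ C ∧ 0 ≤ C' ∧ 0 ≤ A ∧ 0 ≤ A' ∧
      ∀ P, IsOriginPolytope P → ∀ x, f P x = lpCombination p C C' A A' P x := by
  have hp0 : 0 < p := by linarith
  obtain ⟨A, A', hA, hA', hface⟩ := hf.supportDefect_eq_zero hn hp h0 hc
  set F := supportDefect p f A A' with hFdef
  have hF : IsCovariantFunctional p F := isCovariantFunctional_supportDefect hf hp0 A A'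
  have hbound : ∀ a, ∃ C, ∀ s, 0 < s → -C ≤ faceValue F ∅ s a := by
    intro a
    refine ⟨A * supp (stdFace ∅) (WithLp.toLp 2 a) ^ p + A' * supp (stdFace ∅) (WithLp.toLp 2 (-a)) ^ p,
      fun s hs => ?_⟩
    have : 0 ≤ faceValue f ∅ s a := h0 _ ((isOriginPolytope_stdFace _).smul _) _
    rw [hFdef, faceValue_supportDefect _ _ _ hs]
    linarith
  have hlin : ∀ s, 0 < s → ∀ a, faceValue F ∅ s a = s * faceValue F ∅ 1 a := fun s hs a =>
    hF.faceValue_empty_linear hn hface hbound hs a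
  set i₀ : Fin n := ⟨0, by omega⟩
  have hnn : ∀ c : ℝ, 0 ≤ faceValue F ∅ 1 (Pi.single i₀ c) := by
    intro c
    obtain ⟨C, hC⟩ := hbound (Pi.single i₀ c)
    obtain ⟨w, hw, e⟩ := hF.faceValue_empty_of_eq (by omega) (i := ⟨1, by omega⟩) (j := ⟨2, by omega⟩)
      (by simp) (a := Pi.single i₀ c) (by simp [i₀]) hC
    rw [e 1 one_pos, hface _ (Finset.singleton_nonempty _) 1 one_pos, one_mul, zero_add]
    exact hw
  set m := moment p (stdFace ∅) (WithLp.toLp 2 (Pi.single i₀ 1)) with hm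
  have hm0 : 0 < m := moment_stdFace_single_pos hp0 i₀
  set C := faceValue F ∅ 1 (Pi.single i₀ 1) / m with hC
  set C' := faceValue F ∅ 1 (Pi.single i₀ (-1)) / m with hC'
  have hG : IsCovariantFunctional p fun P x => (F P x + -C * moment p P x) + -C' * moment p P (-x) :=
    (hF.linear_combination (isCovariantFunctional_moment hp0) (-C)).linear_combination
      (isCovariantFunctional_moment hp0).reflect (-C')
  set G : Set (Euc n) → Euc n → ℝ :=
    fun P x => (F P x + -C * moment p P x) + -C' * moment p P (-x) with hGdef
  have hGface : ∀ Z s a, faceValue G Z s a =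
      faceValue F Z s a + -C * faceValue (moment p) Z s a + -C' * faceValue (moment p) Z s (-a) := by
    intro Z s a
    rw [← faceValue_reflect]
    rfl
  have hG0 : ∀ Z : Finset (Fin n), Z.Nonempty → ∀ s, 0 < s → ∀ a, faceValue G Z s a = 0 := by
    intro Z hZ s hs a
    rw [hGface, hface Z hZ s hs, faceValue_moment_of_nonempty (by omega) hZ hs,
      faceValue_moment_of_nonempty (by omega) hZ hs]
    ring
  have hGlin : ∀ s, 0 < s → ∀ a, faceValue G ∅ s a = s * faceValue G ∅ 1 a := by
    intro s hs a
    rw [hGface, hGface, hlin s hs, faceValue_moment (by omega) _ hs, faceValue_moment (by omega) _ hs,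
      faceValue_moment (by omega) _ one_pos, faceValue_moment (by omega) _ one_pos]
    ring
  have hneg : ∀ c : ℝ, -(Pi.single i₀ c : Fin n → ℝ) = Pi.single i₀ (-c) := fun c =>
    (Pi.single_neg (f := fun _ => ℝ) i₀ c).symm
  have hGpos : ∀ i, faceValue G ∅ 1 (Pi.single i 1) = 0 := by
    intro i
    rw [hG.faceValue_single_eq hn i i₀ 1 one_pos, hGface, faceValue_moment (by omega) _ one_pos,
      faceValue_moment (by omega) _ one_pos, hneg, moment_stdFace_single_neg hp0, ← hm, hC]
    field_simp
    ring
  have hGneg : ∀ i, faceValue G ∅ 1 (Pi.single i (-1)) = 0 := by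
    intro i
    rw [hG.faceValue_single_eq hn i i₀ (-1) one_pos, hGface, faceValue_moment (by omega) _ one_pos,
      faceValue_moment (by omega) _ one_pos, hneg, neg_neg, moment_stdFace_single_neg hp0, ← hm, hC']
    field_simp
    ring
  refine ⟨C, C', A, A', div_nonneg (hnn _) hm0.le, div_nonneg (hnn _) hm0.le, hA, hA', fun P hP x => ?_⟩
  have := hG.eq_zero_of_faceValue (by omega) (fun Z s hs a => by
    rcases Z.eq_empty_or_nonempty with rfl | hZ
    · exact hG.faceValue_empty_eq_zero hp0 hG0 hGlin hGpos hGneg hs a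
    · exact hG0 Z hZ s hs a) hP x
  simp only [hGdef, hFdef, supportDefect] at this
  rw [lpCombination]
  linarith

lemma supp_midpoint_rpow_le (hp : 1 ≤ p) {K : Set (Euc n)} (hK : IsCompact K) (h0 : 0 ∈ K) (x y : Euc n) :
    supp K ((1 / 2 : ℝ) • (x + y)) ^ p ≤ (supp K x ^ p + supp K y ^ p) / 2 := by
  have h1 : supp K ((1 / 2 : ℝ) • (x + y)) ≤ 1 / 2 * supp K x + 1 / 2 * supp K y := by
    refine supp_le ⟨0, h0⟩ fun z hz => ?_
    rw [real_inner_smul_left, inner_add_left]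
    linarith [inner_le_supp hK x hz, inner_le_supp hK y hz]
  refine (Real.rpow_le_rpow (supp_nonneg hK h0 _) h1 (by linarith)).trans ?_
  have := (convexOn_rpow hp).2 (supp_nonneg hK h0 x) (supp_nonneg hK h0 y)
    (by norm_num : (0 : ℝ) ≤ 1 / 2) (by norm_num : (0 : ℝ) ≤ 1 / 2) (by norm_num)
  simp only [smul_eq_mul] at this
  linarith

lemma eq_rpow_formula_iff (hp : 0 < p) {c₁ c₂ c₃ c₄ : ℝ} (h₁ : 0 ≤ c₁) (h₂ : 0 ≤ c₂) (h₃ : 0 ≤ c₃)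
    (h₄ : 0 ≤ c₄) {P : Set (Euc n)} (hP : IsOriginPolytope P) (x : Euc n) {h : ℝ} (hh : 0 ≤ h) :
    h = ((c₁ * mPlus p P x) ^ p + (c₂ * mMinus p P x) ^ p + (c₃ * supp P x) ^ p
      + (c₄ * supp P (-x)) ^ p) ^ (1 / p) ↔
    h ^ p = lpCombination p (c₁ ^ p) (c₂ ^ p) (c₃ ^ p) (c₄ ^ p) P x := by
  have hs : ∀ x, 0 ≤ supp P x := supp_nonneg hP.isCompact hP.2
  have hroot : ∀ y : ℝ, 0 ≤ y → (y ^ (1 / p)) ^ p = y := fun y hy => by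
    rw [← Real.rpow_mul hy, one_div_mul_cancel hp.ne', Real.rpow_one]
  have e₁ : mPlus p P x = moment p P x ^ (1 / p) := rfl
  have e₂ : mMinus p P x = moment p P (-x) ^ (1 / p) := by
    simp only [mMinus, moment, inner_neg_left]
  have e : (c₁ * mPlus p P x) ^ p + (c₂ * mMinus p P x) ^ p + (c₃ * supp P x) ^ p
      + (c₄ * supp P (-x)) ^ p = lpCombination p (c₁ ^ p) (c₂ ^ p) (c₃ ^ p) (c₄ ^ p) P x := by
    rw [e₁, e₂, Real.mul_rpow h₁ (Real.rpow_nonneg (moment_nonneg _ _) _),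
      Real.mul_rpow h₂ (Real.rpow_nonneg (moment_nonneg _ _) _), Real.mul_rpow h₃ (hs _),
      Real.mul_rpow h₄ (hs _), hroot _ (moment_nonneg _ _), hroot _ (moment_nonneg _ _), lpCombination]
  have hnn : 0 ≤ lpCombination p (c₁ ^ p) (c₂ ^ p) (c₃ ^ p) (c₄ ^ p) P x := by
    have := moment_nonneg (p := p) P x
    have := moment_nonneg (p := p) P (-x)
    have := hs x
    have := hs (-x)
    unfold lpCombination
    positivity
  rw [e, one_div]
  exact Real.eq_rpow_inv hh hnn hp.ne'

lemma isCovariantFunctional_lpCombination (hp : 0 < p) (C C' A A' : ℝ) :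
    IsCovariantFunctional (n := n) p (lpCombination p C C' A A') := by
  have h := isCovariantFunctional_supp_self (n := n) hp
  have hm := isCovariantFunctional_moment (n := n) hp
  convert (((hm.linear_combination hm (C - 1)).linear_combination hm.reflect C').linear_combination h
    A).linear_combination h.reflect A' using 1
  ext P x
  rw [lpCombination]
  ring

lemma lpCombination_union_add_inter (hp : 0 < p) (C C' A A' : ℝ) {K L : Set (Euc n)}
    (hK : IsPolytope0 K) (hL : IsPolytope0 L) (hU : IsPolytope0 (K ∪ L)) (hI : IsPolytope0 (K ∩ L))
    (x : Euc n) :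
    lpCombination p C C' A A' (K ∪ L) x + lpCombination p C C' A A' (K ∩ L) x =
      lpCombination p C C' A A' K x + lpCombination p C C' A A' L x := by
  have hK' := IsOriginPolytope.isCompact hK
  have hL' := IsOriginPolytope.isCompact hL
  have h₁ := moment_union_add_inter hp hK' hL' x
  have h₂ := moment_union_add_inter hp hK' hL' (-x)
  have h₃ := valuationLp_id p K L hK hL hU hI x
  have h₄ := valuationLp_id p K L hK hL hU hI (-x)
  simp only [id] at h₃ h₄
  simp only [lpCombination]
  linear_combination C * h₁ + C' * h₂ + A * h₃ + A' * h₄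

end Classification

/-- Theorem 1.4: for `n ≥ 3` and `1 < p < ∞`, a map `Z : P_o^n → K_o^n` is an `SL(n)`
covariant `L_p` Minkowski valuation iff there are `c₁, c₂, c₃, c₄ ≥ 0` with
`Z P = c₁ M_p⁺P +_p c₂ M_p⁻P +_p c₃ P +_p c₄ (-P)` for every `P ∈ P_o^n` (stated via
support functions; `h_{-P}(x) = h_P(-x)`). -/
theorem sln_covariant_Lp_classification (n : ℕ) (hn : 3 ≤ n) (p : ℝ) (hp : 1 < p)
    (Z : Set (Euc n) → Set (Euc n))
    (hbody : ∀ P : Set (Euc n), IsPolytope0 P → IsConvexBody0 (Z P)) :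
    (ValuationLp p Z ∧ SLCovariant Z) ↔
      ∃ c₁ c₂ c₃ c₄ : ℝ, 0 ≤ c₁ ∧ 0 ≤ c₂ ∧ 0 ≤ c₃ ∧ 0 ≤ c₄ ∧
        ∀ P : Set (Euc n), IsPolytope0 P → ∀ x : Euc n,
          supp (Z P) x = ((c₁ * mPlus p P x) ^ p + (c₂ * mMinus p P x) ^ p
            + (c₃ * supp P x) ^ p + (c₄ * supp P (-x)) ^ p) ^ (1 / p) := by
  have hp0 : 0 < p := by linarith
  have hnn : ∀ P, IsPolytope0 P → ∀ x, 0 ≤ supp (Z P) x := fun P hP =>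
    supp_nonneg (hbody P hP).1 (hbody P hP).2.2
  constructor
  · rintro ⟨hval, hcov⟩
    have hf := isCovariantFunctional_supp hp0 hbody hval hcov
    obtain ⟨C, C', A, A', hC, hC', hA, hA', h⟩ := hf.eq_lpCombination hn hp
      (fun P hP x => Real.rpow_nonneg (hnn P hP x) p)
      (fun P hP => supp_midpoint_rpow_le hp.le (hbody P hP).1 (hbody P hP).2.2)
    have hroot : ∀ y : ℝ, 0 ≤ y → (y ^ (1 / p)) ^ p = y := fun y hy => by
      rw [← Real.rpow_mul hy, one_div_mul_cancel hp0.ne', Real.rpow_one]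
    refine ⟨C ^ (1 / p), C' ^ (1 / p), A ^ (1 / p), A' ^ (1 / p), by positivity, by positivity,
      by positivity, by positivity, fun P hP x => ?_⟩
    rw [eq_rpow_formula_iff hp0 (by positivity) (by positivity) (by positivity) (by positivity) hP x
      (hnn P hP x), hroot C hC, hroot C' hC', hroot A hA, hroot A' hA']
    exact h P hP x
  · rintro ⟨c₁, c₂, c₃, c₄, h₁, h₂, h₃, h₄, h⟩
    have hpow : ∀ P, IsPolytope0 P → ∀ x,
        supp (Z P) x ^ p = lpCombination p (c₁ ^ p) (c₂ ^ p) (c₃ ^ p) (c₄ ^ p) P x := fun P hP x =>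
      (eq_rpow_formula_iff hp0 h₁ h₂ h₃ h₄ hP x (hnn P hP x)).1 (h P hP x)
    constructor
    · intro K L hK hL hU hI x
      rw [hpow _ hK, hpow _ hL, hpow _ hU, hpow _ hI,
        lpCombination_union_add_inter hp0 _ _ _ _ hK hL hU hI]
    · intro φ P hP
      have hφP : IsPolytope0 (matAct (φ : Matrix (Fin n) (Fin n) ℝ) P) := IsOriginPolytope.matAct hP _
      refine eq_of_supp_eq (hbody _ hφP) ((hbody P hP).matAct _) fun x => ?_
      rw [← Real.rpow_left_inj (hnn _ hφP x) (by rw [supp_matAct]; exact hnn P hP _) hp0.ne',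
        supp_matAct, hpow _ hφP, hpow P hP]
      exact (isCovariantFunctional_lpCombination hp0 _ _ _ _).cov φ P hP x
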